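/- arXiv:1610.04674 — 4 statements merged into one kernel-verified Lean document; each statement's English description precedes it below -/
import Mathlib

section
/- (Mini-batch inner-function estimation error bound, eq. (29)) Let a_1, …, a_A be uniform random indices in {1,…,m}, mutually independent, and let x̃, x : Ω → ℝ^N be square-integrable random vectors independent of (a_1,…,a_A). Then for any z ∈ ℝ^N, E‖G(x̃) − (1/A) Σ_{l=1}^A (G_{a_l}(x̃) − G_{a_l}(x)) − G(x)‖² ≤ (8 B_G²/A) · E(‖x̃ − z‖² + ‖x − z‖²). -/
open MeasureTheory ProbabilityTheory
open scoped BigOperators RealInnerProductSpace ENNReal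

noncomputable section

/-- `G(x) = (1/m) ∑ⱼ Gⱼ(x)`. -/
def Gbar {N M m : ℕ} (Gc : Fin m → EuclideanSpace ℝ (Fin N) → EuclideanSpace ℝ (Fin M))
    (x : EuclideanSpace ℝ (Fin N)) : EuclideanSpace ℝ (Fin M) :=
  (m : ℝ)⁻¹ • ∑ j, Gc j x

/-- `∂G(x) = (1/m) ∑ⱼ ∂Gⱼ(x)`. -/
def DGbar {N M m : ℕ}
    (DG : Fin m → EuclideanSpace ℝ (Fin N) → (EuclideanSpace ℝ (Fin N) →L[ℝ] EuclideanSpace ℝ (Fin M)))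
    (x : EuclideanSpace ℝ (Fin N)) : EuclideanSpace ℝ (Fin N) →L[ℝ] EuclideanSpace ℝ (Fin M) :=
  (m : ℝ)⁻¹ • ∑ j, DG j x

/-- `∇F(y) = (1/n) ∑ᵢ ∇Fᵢ(y)`. -/
def gradFbar {M n : ℕ} (gF : Fin n → EuclideanSpace ℝ (Fin M) → EuclideanSpace ℝ (Fin M))
    (y : EuclideanSpace ℝ (Fin M)) : EuclideanSpace ℝ (Fin M) :=
  (n : ℝ)⁻¹ • ∑ i, gF i y

/-- `f(x) = F(G(x)) = (1/n) ∑ᵢ Fᵢ(G(x))`. -/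
def fObj {N M m n : ℕ} (Gc : Fin m → EuclideanSpace ℝ (Fin N) → EuclideanSpace ℝ (Fin M))
    (Fc : Fin n → EuclideanSpace ℝ (Fin M) → ℝ) (x : EuclideanSpace ℝ (Fin N)) : ℝ :=
  (n : ℝ)⁻¹ * ∑ i, Fc i (Gbar Gc x)

/-- `∇f(x) = (∂G(x))ᵀ ∇F(G(x))` (chain rule). -/
def gradf {N M m n : ℕ} (Gc : Fin m → EuclideanSpace ℝ (Fin N) → EuclideanSpace ℝ (Fin M))
    (DG : Fin m → EuclideanSpace ℝ (Fin N) → (EuclideanSpace ℝ (Fin N) →L[ℝ] EuclideanSpace ℝ (Fin M)))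
    (gF : Fin n → EuclideanSpace ℝ (Fin M) → EuclideanSpace ℝ (Fin M))
    (x : EuclideanSpace ℝ (Fin N)) : EuclideanSpace ℝ (Fin N) :=
  ContinuousLinearMap.adjoint (DGbar DG x) (gradFbar gF (Gbar Gc x))

/-- Evaluating a finite family of `L²` vectors at a random index gives an `L²` vector. -/
lemma memLp_two_random_index {Ω F : Type*} [MeasurableSpace Ω] {μ : Measure Ω}
    [NormedAddCommGroup F] {m : ℕ} {a : Ω → Fin m} (ha : Measurable a)
    {X : Fin m → Ω → F} (hX : ∀ c, MemLp (X c) 2 μ) :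
    MemLp (fun ω => X (a ω) ω) 2 μ := by
  classical
  have h : (fun ω => X (a ω) ω) = fun ω => ∑ c, (a ⁻¹' {c}).indicator (X c) ω := by
    funext ω
    simp [Set.indicator_apply]
  rw [h]
  exact memLp_finsetSum _ fun c _ => (hX c).indicator (ha (measurableSet_singleton c))

lemma integrable_inner_of_memLp_two {Ω F : Type*} [MeasurableSpace Ω] {μ : Measure Ω}
    [NormedAddCommGroup F] [InnerProductSpace ℝ F] {X Y : Ω → F}
    (hX : MemLp X 2 μ) (hY : MemLp Y 2 μ) : Integrable (fun ω => ⟪X ω, Y ω⟫) μ :=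
  (hX.norm.integrable_mul hY.norm).mono'
    (hX.aestronglyMeasurable.inner hY.aestronglyMeasurable)
    (.of_forall fun _ => norm_inner_le_norm _ _)

/-- Two independent uniform indices, jointly independent of `Y`, select orthogonal elements
from a family which sums to zero. -/
lemma integral_inner_eq_zero_of_indep_uniform {Ω S F : Type*} [MeasurableSpace Ω]
    {μ : Measure Ω} [MeasurableSpace S]
    [NormedAddCommGroup F] [InnerProductSpace ℝ F] [MeasurableSpace F] [BorelSpace F]
    [SecondCountableTopology F] {m : ℕ} {a b : Ω → Fin m} (ha : Measurable a) (hb : Measurable b)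
    (ha_unif : ∀ c, μ {ω | a ω = c} = (m : ℝ≥0∞)⁻¹)
    (hb_unif : ∀ c, μ {ω | b ω = c} = (m : ℝ≥0∞)⁻¹)
    (hab : IndepFun a b μ) {Y : Ω → S} (hY : IndepFun (fun ω => (a ω, b ω)) Y μ)
    {H : Fin m → S → F} (hH : ∀ c, Measurable (H c)) (hH0 : ∀ y, ∑ c, H c y = 0)
    (hL : ∀ c, MemLp (fun ω => H c (Y ω)) 2 μ) :
    ∫ ω, ⟪H (a ω) (Y ω), H (b ω) (Y ω)⟫ ∂μ = 0 := by
  classical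
  have hint : ∀ c d, Integrable (fun ω => ⟪H c (Y ω), H d (Y ω)⟫) μ :=
    fun c d => integrable_inner_of_memLp_two (hL c) (hL d)
  have hms : ∀ c d, MeasurableSet {ω | (a ω, b ω) = (c, d)} := fun c d =>
    (ha.prodMk hb) (measurableSet_singleton (c, d))
  have hexp : ∀ ω, ⟪H (a ω) (Y ω), H (b ω) (Y ω)⟫ = ∑ c, ∑ d,
      {ω | (a ω, b ω) = (c, d)}.indicator (fun ω => ⟪H c (Y ω), H d (Y ω)⟫) ω := by
    intro ω
    simp [Set.indicator_apply, ite_and]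
  have hterm : ∀ c d, ∫ ω, {ω | (a ω, b ω) = (c, d)}.indicator
      (fun ω => ⟪H c (Y ω), H d (Y ω)⟫) ω ∂μ
      = ((m : ℝ)⁻¹ * (m : ℝ)⁻¹) * ∫ ω, ⟪H c (Y ω), H d (Y ω)⟫ ∂μ := by
    intro c d
    have hprob : μ.real {ω | (a ω, b ω) = (c, d)} = (m : ℝ)⁻¹ * (m : ℝ)⁻¹ := by
      have hset : {ω | (a ω, b ω) = (c, d)} = a ⁻¹' {c} ∩ b ⁻¹' {d} := by
        ext ω; simp
      have h := hab.measure_inter_preimage_eq_mul {c} {d} (measurableSet_singleton c)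
        (measurableSet_singleton d)
      have h1 : μ (a ⁻¹' {c}) = (m : ℝ≥0∞)⁻¹ := ha_unif c
      have h2 : μ (b ⁻¹' {d}) = (m : ℝ≥0∞)⁻¹ := hb_unif d
      rw [measureReal_def, hset, h, h1, h2]
      simp
    have hind : IndepFun (fun ω => ({(c, d)} : Set (Fin m × Fin m)).indicator
        (fun _ => (1 : ℝ)) (a ω, b ω)) (fun ω => ⟪H c (Y ω), H d (Y ω)⟫) μ :=
      hY.comp (φ := ({(c, d)} : Set (Fin m × Fin m)).indicator (fun _ => (1 : ℝ)))
        (ψ := fun y => ⟪H c y, H d y⟫)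
        (measurable_const.indicator (measurableSet_singleton _)) ((hH c).inner (hH d))
    have h := hind.integral_fun_mul_eq_mul_integral
      ((measurable_const.indicator (measurableSet_singleton _)).comp
        (ha.prodMk hb)).aestronglyMeasurable (hint c d).aestronglyMeasurable
    have h1 : ∫ ω, ({(c, d)} : Set (Fin m × Fin m)).indicator
        (fun _ => (1 : ℝ)) (a ω, b ω) ∂μ = (m : ℝ)⁻¹ * (m : ℝ)⁻¹ := by
      rw [← hprob, ← integral_indicator_one (hms c d)]
      rfl
    rw [h1] at h
    rw [← h]
    congr 1
    funext ω
    simp [Set.indicator_apply]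
  simp_rw [hexp]
  rw [integral_finsetSum _ fun c _ => integrable_finsetSum _ fun d _ =>
    (hint c d).indicator (hms c d)]
  simp_rw [integral_finsetSum _ fun d _ => (hint _ d).indicator (hms _ d), hterm,
    ← Finset.mul_sum]
  simp_rw [← integral_finsetSum _ fun d _ => hint _ d]
  simp [← inner_sum, hH0]

/-- The squared norm of a sum of pairwise orthogonal `L²` vectors integrates to the sum of the
integrals of the squared norms. -/
lemma integral_norm_sum_sq_of_orthogonal {Ω F : Type*} [MeasurableSpace Ω] {μ : Measure Ω}
    [NormedAddCommGroup F] [InnerProductSpace ℝ F] {ι : Type*} [Fintype ι]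
    {U : ι → Ω → F} (hU : ∀ l, MemLp (U l) 2 μ)
    (horth : ∀ l k, l ≠ k → ∫ ω, ⟪U l ω, U k ω⟫ ∂μ = 0) :
    ∫ ω, ‖∑ l, U l ω‖ ^ 2 ∂μ = ∑ l, ∫ ω, ‖U l ω‖ ^ 2 ∂μ := by
  have hint : ∀ l k, Integrable (fun ω => ⟪U l ω, U k ω⟫) μ :=
    fun l k => integrable_inner_of_memLp_two (hU l) (hU k)
  simp_rw [← real_inner_self_eq_norm_sq, sum_inner, inner_sum]
  rw [integral_finsetSum _ fun l _ => integrable_finsetSum _ fun k _ => hint l k]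
  refine Finset.sum_congr rfl fun l _ => ?_
  rw [integral_finsetSum _ fun k _ => hint l k]
  exact Finset.sum_eq_single l (fun k _ hk => horth l k hk.symm) (by simp)

/-- The average of finitely many maps with derivatives bounded by `B` is `B`-Lipschitz. -/
lemma norm_Gbar_sub_le {N M m : ℕ} (hm : 0 < m)
    {Gc : Fin m → EuclideanSpace ℝ (Fin N) → EuclideanSpace ℝ (Fin M)} {B : ℝ}
    (hG : ∀ j u v, ‖Gc j u - Gc j v‖ ≤ B * ‖u - v‖) (u v : EuclideanSpace ℝ (Fin N)) :
    ‖Gbar Gc u - Gbar Gc v‖ ≤ B * ‖u - v‖ := by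
  have hm' : (0 : ℝ) < m := by exact_mod_cast hm
  rw [Gbar, Gbar, ← smul_sub, ← Finset.sum_sub_distrib, norm_smul, norm_inv, Real.norm_natCast,
    inv_mul_le_iff₀ hm']
  refine (norm_sum_le _ _).trans ((Finset.sum_le_sum fun j _ => hG j u v).trans ?_)
  simp

/-- Deviation of the increment of the `j`-th component from the mean increment. -/
def incrementDeviation {N M m : ℕ}
    (Gc : Fin m → EuclideanSpace ℝ (Fin N) → EuclideanSpace ℝ (Fin M))
    (j : Fin m) (y : EuclideanSpace ℝ (Fin N) × EuclideanSpace ℝ (Fin N)) :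
    EuclideanSpace ℝ (Fin M) :=
  (Gc j y.1 - Gc j y.2) - (Gbar Gc y.1 - Gbar Gc y.2)

lemma sum_incrementDeviation {N M m : ℕ} (hm : 0 < m)
    (Gc : Fin m → EuclideanSpace ℝ (Fin N) → EuclideanSpace ℝ (Fin M))
    (y : EuclideanSpace ℝ (Fin N) × EuclideanSpace ℝ (Fin N)) :
    ∑ j, incrementDeviation Gc j y = 0 := by
  have hm' : (m : ℝ) ≠ 0 := by exact_mod_cast hm.ne'
  simp only [incrementDeviation, Finset.sum_sub_distrib, Finset.sum_const, Finset.card_univ,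
    Fintype.card_fin, Gbar]
  rw [← Nat.cast_smul_eq_nsmul ℝ, ← Nat.cast_smul_eq_nsmul ℝ, smul_inv_smul₀ hm',
    smul_inv_smul₀ hm', sub_self]

lemma norm_incrementDeviation_le {N M m : ℕ} (hm : 0 < m)
    {Gc : Fin m → EuclideanSpace ℝ (Fin N) → EuclideanSpace ℝ (Fin M)} {B : ℝ}
    (hG : ∀ j u v, ‖Gc j u - Gc j v‖ ≤ B * ‖u - v‖) (j : Fin m)
    (y : EuclideanSpace ℝ (Fin N) × EuclideanSpace ℝ (Fin N)) :
    ‖incrementDeviation Gc j y‖ ≤ 2 * B * ‖y.1 - y.2‖ := by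
  have h := norm_sub_le (Gc j y.1 - Gc j y.2) (Gbar Gc y.1 - Gbar Gc y.2)
  have h1 := hG j y.1 y.2
  have h2 := norm_Gbar_sub_le hm hG y.1 y.2
  unfold incrementDeviation
  linarith

lemma continuous_incrementDeviation {N M m : ℕ}
    {Gc : Fin m → EuclideanSpace ℝ (Fin N) → EuclideanSpace ℝ (Fin M)}
    (hG : ∀ j, Continuous (Gc j)) (j : Fin m) : Continuous (incrementDeviation Gc j) := by
  unfold incrementDeviation Gbar
  fun_prop

lemma norm_incrementDeviation_sq_le {N M m : ℕ} (hm : 0 < m)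
    {Gc : Fin m → EuclideanSpace ℝ (Fin N) → EuclideanSpace ℝ (Fin M)} {B : ℝ}
    (hG : ∀ j u v, ‖Gc j u - Gc j v‖ ≤ B * ‖u - v‖) (j : Fin m)
    (u v z : EuclideanSpace ℝ (Fin N)) :
    ‖incrementDeviation Gc j (u, v)‖ ^ 2 ≤ 8 * B ^ 2 * (‖u - z‖ ^ 2 + ‖v - z‖ ^ 2) := by
  have h1 := pow_le_pow_left₀ (norm_nonneg _) (norm_incrementDeviation_le hm hG j (u, v)) 2
  have h2 : ‖u - v‖ ≤ ‖u - z‖ + ‖v - z‖ := by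
    simpa using norm_sub_le (u - z) (v - z)
  have h3 : ‖u - v‖ ^ 2 ≤ 2 * (‖u - z‖ ^ 2 + ‖v - z‖ ^ 2) := by
    nlinarith [pow_le_pow_left₀ (norm_nonneg _) h2 2, sq_nonneg (‖u - z‖ - ‖v - z‖)]
  calc _ ≤ 4 * B ^ 2 * ‖u - v‖ ^ 2 := by simpa [mul_pow] using h1.trans_eq (by ring)
    _ ≤ 4 * B ^ 2 * (2 * (‖u - z‖ ^ 2 + ‖v - z‖ ^ 2)) := by gcongr
    _ = _ := by ring

/-- Eq. (29): mini-batch inner-function estimation error bound. -/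
theorem stmt4
    (N M m n : ℕ) (hN : 0 < N) (hM : 0 < M) (hm : 0 < m) (hn : 0 < n)
    (Gc : Fin m → EuclideanSpace ℝ (Fin N) → EuclideanSpace ℝ (Fin M))
    (DG : Fin m → EuclideanSpace ℝ (Fin N) → (EuclideanSpace ℝ (Fin N) →L[ℝ] EuclideanSpace ℝ (Fin M)))
    (hGc : ∀ j, ContDiff ℝ 1 (Gc j))
    (hDG : ∀ (j : Fin m) (x : EuclideanSpace ℝ (Fin N)), HasFDerivAt (Gc j) (DG j x) x)
    (BG : ℝ) (hBG : 0 < BG)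
    (hBGb : ∀ (j : Fin m) (x : EuclideanSpace ℝ (Fin N)), ‖DG j x‖ ≤ BG)
    (Ω : Type*) [MeasurableSpace Ω] (μ : Measure Ω) [IsProbabilityMeasure μ]
    (A : ℕ) (hA : 1 ≤ A)
    (a : Fin A → Ω → Fin m)
    (ha_meas : ∀ l, Measurable (a l))
    (ha_unif : ∀ (l : Fin A) (c : Fin m), μ {ω | a l ω = c} = (m : ℝ≥0∞)⁻¹)
    (ha_indep : iIndepFun (m := fun _ : Fin A => (inferInstance : MeasurableSpace (Fin m))) a μ)
    (xt x : Ω → EuclideanSpace ℝ (Fin N))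
    (hxt : MemLp xt 2 μ) (hx : MemLp x 2 μ)
    (hindep : IndepFun (fun ω => fun l : Fin A => a l ω) (fun ω => (xt ω, x ω)) μ) :
    ∀ z : EuclideanSpace ℝ (Fin N),
      ∫ ω, ‖Gbar Gc (xt ω) - (A : ℝ)⁻¹ • ∑ l : Fin A, (Gc (a l ω) (xt ω) - Gc (a l ω) (x ω))
            - Gbar Gc (x ω)‖ ^ 2 ∂μ
        ≤ 8 * BG ^ 2 / (A : ℝ) * ∫ ω, (‖xt ω - z‖ ^ 2 + ‖x ω - z‖ ^ 2) ∂μ := by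
  intro z
  have hA' : (0 : ℝ) < A := by exact_mod_cast hA
  have hcont : ∀ j, Continuous (Gc j) := fun j => (hGc j).continuous
  have hlip : ∀ j u v, ‖Gc j u - Gc j v‖ ≤ BG * ‖u - v‖ := fun j u v =>
    convex_univ.norm_image_sub_le_of_norm_hasFDerivWithin_le
      (fun w _ => (hDG j w).hasFDerivWithinAt) (fun w _ => hBGb j w) (Set.mem_univ v)
      (Set.mem_univ u)
  have hHc := continuous_incrementDeviation hcont
  have hL : ∀ c, MemLp (fun ω => incrementDeviation Gc c (xt ω, x ω)) 2 μ := fun c =>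
    (hxt.sub hx).of_le_mul (c := 2 * BG)
      ((hHc c).comp_aestronglyMeasurable
        (hxt.aestronglyMeasurable.prodMk hx.aestronglyMeasurable))
      (.of_forall fun ω => norm_incrementDeviation_le hm hlip c (xt ω, x ω))
  have hU : ∀ l, MemLp (fun ω => incrementDeviation Gc (a l ω) (xt ω, x ω)) 2 μ := fun l =>
    memLp_two_random_index (ha_meas l) hL
  have horth : ∀ l k, l ≠ k → ∫ ω, ⟪incrementDeviation Gc (a l ω) (xt ω, x ω),
      incrementDeviation Gc (a k ω) (xt ω, x ω)⟫ ∂μ = 0 := fun l k hlk =>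
    integral_inner_eq_zero_of_indep_uniform (ha_meas l) (ha_meas k) (ha_unif l) (ha_unif k)
      (ha_indep.indepFun hlk)
      (hindep.comp (φ := fun α : Fin A → Fin m => (α l, α k)) (ψ := id)
        ((measurable_pi_apply l).prodMk (measurable_pi_apply k)) measurable_id)
      (fun c => (hHc c).measurable) (sum_incrementDeviation hm Gc) hL
  have hdecomp : ∀ ω, ‖Gbar Gc (xt ω)
      - (A : ℝ)⁻¹ • ∑ l : Fin A, (Gc (a l ω) (xt ω) - Gc (a l ω) (x ω)) - Gbar Gc (x ω)‖ ^ 2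
      = ((A : ℝ)⁻¹) ^ 2 * ‖∑ l, incrementDeviation Gc (a l ω) (xt ω, x ω)‖ ^ 2 := by
    intro ω
    have h : Gbar Gc (xt ω)
        - (A : ℝ)⁻¹ • ∑ l : Fin A, (Gc (a l ω) (xt ω) - Gc (a l ω) (x ω)) - Gbar Gc (x ω)
        = -((A : ℝ)⁻¹ • ∑ l, incrementDeviation Gc (a l ω) (xt ω, x ω)) := by
      simp only [incrementDeviation]
      rw [Finset.sum_sub_distrib _ (fun _ : Fin A => Gbar Gc (xt ω) - Gbar Gc (x ω)),
        Finset.sum_const, Finset.card_univ, Fintype.card_fin,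
        ← Nat.cast_smul_eq_nsmul ℝ, smul_sub, inv_smul_smul₀ hA'.ne']
      abel
    rw [h, norm_neg, norm_smul, mul_pow, norm_inv, Real.norm_natCast]
  have hbound : Integrable (fun ω => ‖xt ω - z‖ ^ 2 + ‖x ω - z‖ ^ 2) μ :=
    (hxt.sub (memLp_const z)).integrable_norm_pow' |>.add
      (hx.sub (memLp_const z)).integrable_norm_pow'
  have hdiag : ∀ l, ∫ ω, ‖incrementDeviation Gc (a l ω) (xt ω, x ω)‖ ^ 2 ∂μ
      ≤ 8 * BG ^ 2 * ∫ ω, (‖xt ω - z‖ ^ 2 + ‖x ω - z‖ ^ 2) ∂μ := by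
    intro l
    rw [← integral_const_mul]
    exact integral_mono (hU l).integrable_norm_pow' (hbound.const_mul _) fun ω =>
      norm_incrementDeviation_sq_le hm hlip (a l ω) (xt ω) (x ω) z
  simp_rw [hdecomp]
  rw [integral_const_mul, integral_norm_sum_sq_of_orthogonal hU horth]
  calc _ ≤ ((A : ℝ)⁻¹) ^ 2 * ∑ _l : Fin A,
        (8 * BG ^ 2 * ∫ ω, (‖xt ω - z‖ ^ 2 + ‖x ω - z‖ ^ 2) ∂μ) := by
        gcongr with l
        exact hdiag l
    _ = _ := by
        rw [Finset.sum_const, Finset.card_univ, Fintype.card_fin, nsmul_eq_mul]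
        field_simp
end
end

section
/- (Lower bound on the inner product term T_1 for Compositional-SVRG-1, eq. (22)) Let x : Ω → ℝ^N and Ĝ : Ω → ℝ^M be square-integrable random vectors, let i be a uniform random index in {1,…,n} and j a uniform random index in {1,…,m}, with i, j mutually independent and independent of (x, Ĝ). Then E⟨(∂G_j(x))^⊤ ∇F_i(Ĝ), x − x*⟩ ≥ −(8 B_G² L_F²/μ_f) · E‖Ĝ − G(x)‖² + (7 μ_f/8) · E‖x − x*‖². -/
open MeasureTheory ProbabilityTheory
open scoped BigOperators RealInnerProductSpace ENNReal

noncomputable section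

section

lemma integral_eq_sum_of_indepFun {Ω κ β : Type*} [MeasurableSpace Ω] [MeasurableSpace β]
    [Fintype κ] [MeasurableSpace κ] [MeasurableSingletonClass κ]
    {μ : Measure Ω} [IsProbabilityMeasure μ] {K : Ω → κ} {Z : Ω → β}
    (hK : Measurable K) (hKZ : IndepFun K Z μ) {h : κ → β → ℝ} (hh : ∀ k, Measurable (h k))
    (hint : ∀ k, Integrable (fun ω => h k (Z ω)) μ) :
    ∫ ω, h (K ω) (Z ω) ∂μ = ∑ k, μ.real (K ⁻¹' {k}) * ∫ ω, h k (Z ω) ∂μ := by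
  classical
  have hsplit : ∀ ω, h (K ω) (Z ω) =
      ∑ k, (K ⁻¹' {k}).indicator (fun ω => h k (Z ω)) ω := by
    intro ω
    simp [Set.indicator_apply]
  simp_rw [hsplit]
  rw [integral_finsetSum _ fun k _ => (hint k).indicator (hK (measurableSet_singleton k))]
  refine Finset.sum_congr rfl fun k _ => ?_
  have hone : Measurable (({k} : Set κ).indicator (1 : κ → ℝ)) :=
    measurable_one.indicator (measurableSet_singleton k)
  have hmul := (hKZ.comp hone (hh k)).integral_fun_mul_eq_mul_integral
    (hone.comp hK).aestronglyMeasurable (hint k).aestronglyMeasurable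
  have hprob : ∫ ω, ({k} : Set κ).indicator (1 : κ → ℝ) (K ω) ∂μ = μ.real (K ⁻¹' {k}) := by
    rw [← integral_indicator_one (hK (measurableSet_singleton k))]
    rfl
  simp only [Function.comp_apply] at hmul
  rw [hprob] at hmul
  rw [← hmul]
  refine integral_congr_ae (.of_forall fun ω => ?_)
  by_cases hk : K ω = k <;> simp [hk]

lemma measureReal_prodMk_eq_mul {Ω : Type*} [MeasurableSpace Ω] {μ : Measure Ω} {n m : ℕ}
    {i : Ω → Fin n} {j : Ω → Fin m}
    (hi : ∀ c, μ {ω | i ω = c} = (n : ℝ≥0∞)⁻¹) (hj : ∀ c, μ {ω | j ω = c} = (m : ℝ≥0∞)⁻¹)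
    (hij : IndepFun i j μ) (k : Fin n × Fin m) :
    μ.real ((fun ω => (i ω, j ω)) ⁻¹' {k}) = (n : ℝ)⁻¹ * (m : ℝ)⁻¹ := by
  have hset : (fun ω => (i ω, j ω)) ⁻¹' {k} = i ⁻¹' {k.1} ∩ j ⁻¹' {k.2} := by
    ext ω
    simp [Prod.ext_iff]
  rw [hset, measureReal_def, hij.measure_inter_preimage_eq_mul _ _ (measurableSet_singleton _)
    (measurableSet_singleton _), show μ (i ⁻¹' {k.1}) = _ from hi k.1,
    show μ (j ⁻¹' {k.2}) = _ from hj k.2]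
  simp

/-- Quadratic growth, up to the factor `1 - t`, follows from the strong convexity inequality at the
point `x₀ + t (x - x₀)`. -/
lemma quadratic_growth {E : Type*} [NormedAddCommGroup E] [InnerProductSpace ℝ E]
    {f : E → ℝ} {g : E → E} {c : ℝ}
    (hsc : ∀ x y, f y ≥ f x + ⟪g x, y - x⟫ + c / 2 * ‖y - x‖ ^ 2)
    {x₀ : E} (hmin : ∀ x, f x₀ ≤ f x) (x : E) {t : ℝ} (ht : 0 < t) (ht1 : t ≤ 1) :
    (1 - t) * (c / 2 * ‖x - x₀‖ ^ 2) ≤ f x - f x₀ := by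
  have h₀ := hsc (x₀ + t • (x - x₀)) x₀
  have h₁ := hsc (x₀ + t • (x - x₀)) x
  rw [show x₀ - (x₀ + t • (x - x₀)) = (-t) • (x - x₀) by module, norm_smul, inner_smul_right,
    mul_pow, Real.norm_eq_abs, sq_abs] at h₀
  rw [show x - (x₀ + t • (x - x₀)) = (1 - t) • (x - x₀) by module, norm_smul, inner_smul_right,
    mul_pow, Real.norm_eq_abs, sq_abs] at h₁
  have hm := hmin (x₀ + t • (x - x₀))
  refine le_of_mul_le_mul_left ?_ ht
  linear_combination (1 - t) * h₀ + t * h₁ + hm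

lemma inner_gradient_ge {E : Type*} [NormedAddCommGroup E] [InnerProductSpace ℝ E]
    {f : E → ℝ} {g : E → E} {c : ℝ}
    (hsc : ∀ x y, f y ≥ f x + ⟪g x, y - x⟫ + c / 2 * ‖y - x‖ ^ 2)
    {x₀ : E} (hmin : ∀ x, f x₀ ≤ f x) (x : E) {t : ℝ} (ht : 0 < t) (ht1 : t ≤ 1) :
    (1 - t / 2) * c * ‖x - x₀‖ ^ 2 ≤ ⟪g x, x - x₀⟫ := by
  have h₀ := hsc x x₀
  have h₁ := quadratic_growth hsc hmin x ht ht1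
  rw [← neg_sub x x₀, inner_neg_right, norm_neg] at h₀
  linarith

lemma norm_inv_smul_sum_le {E : Type*} [SeminormedAddCommGroup E] [NormedSpace ℝ E] {n : ℕ}
    {v : Fin n → E} {C : ℝ} (hC : 0 ≤ C) (hv : ∀ k, ‖v k‖ ≤ C) :
    ‖(n : ℝ)⁻¹ • ∑ k, v k‖ ≤ C := by
  rcases Nat.eq_zero_or_pos n with rfl | hn
  · simpa using hC
  have hsum : ‖∑ k, v k‖ ≤ n * C := by
    simpa using norm_sum_le_of_le Finset.univ fun k _ => hv k
  rw [norm_smul, norm_inv, RCLike.norm_natCast, inv_mul_le_iff₀ (by positivity)]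
  exact hsum

variable {N M m n : ℕ}

lemma inner_average_eq_sum
    (DG : Fin m → EuclideanSpace ℝ (Fin N) → EuclideanSpace ℝ (Fin N) →L[ℝ] EuclideanSpace ℝ (Fin M))
    (gF : Fin n → EuclideanSpace ℝ (Fin M) → EuclideanSpace ℝ (Fin M))
    (x w : EuclideanSpace ℝ (Fin N)) (y : EuclideanSpace ℝ (Fin M)) :
    ⟪gradFbar gF y, DGbar DG x w⟫ = ∑ k : Fin n × Fin m,
      (n : ℝ)⁻¹ * (m : ℝ)⁻¹ * ⟪ContinuousLinearMap.adjoint (DG k.2 x) (gF k.1 y), w⟫ := by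
  simp_rw [ContinuousLinearMap.adjoint_inner_left, gradFbar, DGbar, ← Finset.mul_sum,
    Fintype.sum_prod_type, smul_apply, sum_apply,
    inner_smul_left, inner_smul_right, sum_inner, inner_sum, mul_assoc]
  rfl

lemma inner_average_ge
    {Gc : Fin m → EuclideanSpace ℝ (Fin N) → EuclideanSpace ℝ (Fin M)}
    {DG : Fin m → EuclideanSpace ℝ (Fin N) → EuclideanSpace ℝ (Fin N) →L[ℝ] EuclideanSpace ℝ (Fin M)}
    {Fc : Fin n → EuclideanSpace ℝ (Fin M) → ℝ}
    {gF : Fin n → EuclideanSpace ℝ (Fin M) → EuclideanSpace ℝ (Fin M)}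
    {BG LF μf : ℝ} (hBG : 0 ≤ BG) (hBGb : ∀ j x, ‖DG j x‖ ≤ BG)
    (hLF : 0 ≤ LF) (hLFb : ∀ i u v, ‖gF i u - gF i v‖ ≤ LF * ‖u - v‖) (hμf : 0 < μf)
    (hsc : ∀ x y : EuclideanSpace ℝ (Fin N),
      fObj Gc Fc y ≥ fObj Gc Fc x + ⟪gradf Gc DG gF x, y - x⟫ + μf / 2 * ‖y - x‖ ^ 2)
    {xstar : EuclideanSpace ℝ (Fin N)} (hxstar : ∀ x, fObj Gc Fc xstar ≤ fObj Gc Fc x)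
    (x : EuclideanSpace ℝ (Fin N)) (y : EuclideanSpace ℝ (Fin M)) :
    (-(8 * BG ^ 2 * LF ^ 2 / μf)) * ‖y - Gbar Gc x‖ ^ 2 + 7 * μf / 8 * ‖x - xstar‖ ^ 2
      ≤ ⟪gradFbar gF y, DGbar DG x (x - xstar)⟫ := by
  have hmono := inner_gradient_ge hsc hxstar x (t := 3 / 16) (by norm_num) (by norm_num)
  rw [gradf, ContinuousLinearMap.adjoint_inner_left] at hmono
  have hgrad : ‖gradFbar gF y - gradFbar gF (Gbar Gc x)‖ ≤ LF * ‖y - Gbar Gc x‖ := by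
    rw [gradFbar, gradFbar, ← smul_sub, ← Finset.sum_sub_distrib]
    exact norm_inv_smul_sum_le (by positivity) fun k => hLFb k _ _
  have hjac : ‖DGbar DG x (x - xstar)‖ ≤ BG * ‖x - xstar‖ :=
    (DGbar DG x).le_of_opNorm_le (norm_inv_smul_sum_le hBG fun k => hBGb k x) _
  have herr : -(LF * ‖y - Gbar Gc x‖ * (BG * ‖x - xstar‖))
      ≤ ⟪gradFbar gF y - gradFbar gF (Gbar Gc x), DGbar DG x (x - xstar)⟫ :=
    (abs_le.1 ((abs_real_inner_le_norm _ _).trans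
      (mul_le_mul hgrad hjac (norm_nonneg _) (by positivity)))).1
  rw [inner_sub_left] at herr
  have hyoung : LF * ‖y - Gbar Gc x‖ * (BG * ‖x - xstar‖)
      ≤ 8 * BG ^ 2 * LF ^ 2 / μf * ‖y - Gbar Gc x‖ ^ 2 + μf / 32 * ‖x - xstar‖ ^ 2 := by
    have hsq : 0 ≤ (16 * (BG * LF * ‖y - Gbar Gc x‖) - μf * ‖x - xstar‖) ^ 2 / (32 * μf) := by
      positivity
    have hexp : (16 * (BG * LF * ‖y - Gbar Gc x‖) - μf * ‖x - xstar‖) ^ 2 / (32 * μf)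
        = 8 * BG ^ 2 * LF ^ 2 / μf * ‖y - Gbar Gc x‖ ^ 2 + μf / 32 * ‖x - xstar‖ ^ 2
          - LF * ‖y - Gbar Gc x‖ * (BG * ‖x - xstar‖) := by
      field_simp
      ring
    linarith
  linarith

lemma lipschitzWith_Gbar
    {Gc : Fin m → EuclideanSpace ℝ (Fin N) → EuclideanSpace ℝ (Fin M)}
    {DG : Fin m → EuclideanSpace ℝ (Fin N) → EuclideanSpace ℝ (Fin N) →L[ℝ] EuclideanSpace ℝ (Fin M)}
    (hDG : ∀ j x, HasFDerivAt (Gc j) (DG j x) x)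
    {BG : ℝ} (hBG : 0 ≤ BG) (hBGb : ∀ j x, ‖DG j x‖ ≤ BG) :
    LipschitzWith BG.toNNReal (Gbar Gc) := by
  refine LipschitzWith.of_dist_le_mul fun u v => ?_
  rw [dist_eq_norm, dist_eq_norm, Real.coe_toNNReal _ hBG, Gbar, Gbar, ← smul_sub,
    ← Finset.sum_sub_distrib]
  exact norm_inv_smul_sum_le (by positivity) fun k =>
    convex_univ.norm_image_sub_le_of_norm_hasFDerivWithin_le
      (fun z _ => (hDG k z).hasFDerivWithinAt) (fun z _ => hBGb k z) (Set.mem_univ v)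
      (Set.mem_univ u)

lemma LipschitzWith.memLp_comp {Ω E F : Type*} [MeasurableSpace Ω] {μ : Measure Ω}
    [IsFiniteMeasure μ] [NormedAddCommGroup E] [NormedAddCommGroup F] {K : NNReal} {g : E → F}
    (hg : LipschitzWith K g) {p : ℝ≥0∞} {f : Ω → E} (hf : MemLp f p μ) :
    MemLp (fun ω => g (f ω)) p μ := by
  have hshift : LipschitzWith K fun z => g z - g 0 := by
    simpa using hg.sub (LipschitzWith.const (g 0))
  convert (hshift.comp_memLp (sub_self _) hf).add (memLp_const (μ := μ) (p := p) (g 0)) using 1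
  ext ω
  simp

end

/-- Eq. (22): lower bound on the inner product term `T₁` for Compositional-SVRG-1. -/
theorem stmt5
    (N M m n : ℕ) (hN : 0 < N) (hM : 0 < M) (hm : 0 < m) (hn : 0 < n)
    (Gc : Fin m → EuclideanSpace ℝ (Fin N) → EuclideanSpace ℝ (Fin M))
    (DG : Fin m → EuclideanSpace ℝ (Fin N) → (EuclideanSpace ℝ (Fin N) →L[ℝ] EuclideanSpace ℝ (Fin M)))
    (hGc : ∀ j, ContDiff ℝ 1 (Gc j))
    (hDG : ∀ (j : Fin m) (x : EuclideanSpace ℝ (Fin N)), HasFDerivAt (Gc j) (DG j x) x)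
    (Fc : Fin n → EuclideanSpace ℝ (Fin M) → ℝ)
    (gF : Fin n → EuclideanSpace ℝ (Fin M) → EuclideanSpace ℝ (Fin M))
    (hFc : ∀ i, ContDiff ℝ 1 (Fc i))
    (hgF : ∀ (i : Fin n) (y : EuclideanSpace ℝ (Fin M)), HasGradientAt (Fc i) (gF i y) y)
    (BG : ℝ) (hBG : 0 < BG)
    (hBGb : ∀ (j : Fin m) (x : EuclideanSpace ℝ (Fin N)), ‖DG j x‖ ≤ BG)
    (LF : ℝ) (hLF : 0 < LF)
    (hLFb : ∀ (i : Fin n) (u v : EuclideanSpace ℝ (Fin M)), ‖gF i u - gF i v‖ ≤ LF * ‖u - v‖)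
    (μf : ℝ) (hμf : 0 < μf)
    (hsc : ∀ x y : EuclideanSpace ℝ (Fin N),
      fObj Gc Fc y ≥ fObj Gc Fc x + ⟪gradf Gc DG gF x, y - x⟫ + μf / 2 * ‖y - x‖ ^ 2)
    (xstar : EuclideanSpace ℝ (Fin N)) (hxstar : ∀ x, fObj Gc Fc xstar ≤ fObj Gc Fc x)
    (Ω : Type*) [MeasurableSpace Ω] (μ : Measure Ω) [IsProbabilityMeasure μ]
    (x : Ω → EuclideanSpace ℝ (Fin N)) (Gh : Ω → EuclideanSpace ℝ (Fin M))
    (hx : MemLp x 2 μ) (hGh : MemLp Gh 2 μ)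
    (i : Ω → Fin n) (j : Ω → Fin m)
    (hi_meas : Measurable i) (hj_meas : Measurable j)
    (hi_unif : ∀ c : Fin n, μ {ω | i ω = c} = (n : ℝ≥0∞)⁻¹)
    (hj_unif : ∀ c : Fin m, μ {ω | j ω = c} = (m : ℝ≥0∞)⁻¹)
    (hij : IndepFun i j μ)
    (hind : IndepFun (fun ω => (i ω, j ω)) (fun ω => (x ω, Gh ω)) μ) :
    ∫ ω, (⟪ContinuousLinearMap.adjoint (DG (j ω) (x ω)) (gF (i ω) (Gh ω)), x ω - xstar⟫) ∂μ
      ≥ (-(8 * BG ^ 2 * LF ^ 2 / μf)) * ∫ ω, ‖Gh ω - Gbar Gc (x ω)‖ ^ 2 ∂μ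
        + 7 * μf / 8 * ∫ ω, ‖x ω - xstar‖ ^ 2 ∂μ := by
  have hGb : LipschitzWith BG.toNNReal (Gbar Gc) := lipschitzWith_Gbar hDG hBG.le hBGb
  have hgF_lip : ∀ k, LipschitzWith LF.toNNReal (gF k) := fun k =>
    LipschitzWith.of_dist_le_mul fun u v => by
      simpa [dist_eq_norm, Real.coe_toNNReal _ hLF.le] using hLFb k u v
  have hDG_cont : ∀ k, Continuous (DG k) := fun k => by
    have hfderiv : fderiv ℝ (Gc k) = DG k := funext fun z => (hDG k z).fderiv
    exact hfderiv ▸ (hGc k).continuous_fderiv one_ne_zero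
  have hdist : MemLp (fun ω => x ω - xstar) 2 μ := hx.sub (memLp_const xstar)
  have herr : MemLp (fun ω => Gh ω - Gbar Gc (x ω)) 2 μ := hGh.sub (hGb.memLp_comp hx)
  set h : Fin n × Fin m → EuclideanSpace ℝ (Fin N) × EuclideanSpace ℝ (Fin M) → ℝ := fun k z =>
    ⟪ContinuousLinearMap.adjoint (DG k.2 z.1) (gF k.1 z.2), z.1 - xstar⟫ with hh
  have hh_cont : ∀ k, Continuous (h k) := fun k => by
    have hgF_cont := (hgF_lip k.1).continuous
    have hDGk := hDG_cont k.2
    simp only [hh, ContinuousLinearMap.adjoint_inner_left]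
    fun_prop
  have hh_int : ∀ k, Integrable (fun ω => h k (x ω, Gh ω)) μ := fun k => by
    have hgrad : MemLp (fun ω => gF k.1 (Gh ω)) 2 μ := (hgF_lip k.1).memLp_comp hGh
    refine ((hgrad.norm.integrable_mul hdist.norm).const_mul BG).mono'
      ((hh_cont k).comp_aestronglyMeasurable
        (hx.aestronglyMeasurable.prodMk hGh.aestronglyMeasurable)) (.of_forall fun ω => ?_)
    simp only [hh, ContinuousLinearMap.adjoint_inner_left, Pi.mul_apply]
    calc ‖⟪gF k.1 (Gh ω), DG k.2 (x ω) (x ω - xstar)⟫‖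
        ≤ ‖gF k.1 (Gh ω)‖ * ‖DG k.2 (x ω) (x ω - xstar)‖ := norm_inner_le_norm _ _
      _ ≤ ‖gF k.1 (Gh ω)‖ * (BG * ‖x ω - xstar‖) := by
          gcongr
          exact (DG k.2 (x ω)).le_of_opNorm_le (hBGb _ _) _
      _ = BG * (‖gF k.1 (Gh ω)‖ * ‖x ω - xstar‖) := by ring
  have hexp : ∫ ω, ⟪ContinuousLinearMap.adjoint (DG (j ω) (x ω)) (gF (i ω) (Gh ω)), x ω - xstar⟫ ∂μ
      = ∫ ω, ⟪gradFbar gF (Gh ω), DGbar DG (x ω) (x ω - xstar)⟫ ∂μ := by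
    simp_rw [inner_average_eq_sum]
    rw [integral_finsetSum _ fun k _ => (hh_int k).const_mul _]
    refine (integral_eq_sum_of_indepFun (hi_meas.prodMk hj_meas) hind
      (fun k => (hh_cont k).measurable) hh_int).trans (Finset.sum_congr rfl fun k _ => ?_)
    rw [measureReal_prodMk_eq_mul hi_unif hj_unif hij, integral_const_mul]
  have hint_err := herr.norm.integrable_sq
  have hint_dist := hdist.norm.integrable_sq
  rw [hexp, ge_iff_le, ← integral_const_mul, ← integral_const_mul,
    ← integral_add (hint_err.const_mul _) (hint_dist.const_mul _)]
  refine integral_mono ((hint_err.const_mul _).add (hint_dist.const_mul _)) ?_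
    fun ω => inner_average_ge hBG.le hBGb hLF.le hLFb hμf hsc hxstar (x ω) (Gh ω)
  simp_rw [inner_average_eq_sum]
  exact integrable_finsetSum _ fun k _ => (hh_int k).const_mul _
end
end

section
/- (One-step recurrence for Compositional-SVRG-1) With C := (16 γ B_G² L_F²/μ_f + 4 γ² B_G² L_F²) · (8 B_G²/A), the iterate x⁺ produced by one step of Compositional-SVRG-1 satisfies E‖x⁺ − x*‖² ≤ (1 − 7 μ_f γ/4 + C + 8 γ² L_f²) · E‖x − x*‖² + (C + 10 γ² L_f²) · E‖x̃ − x*‖². -/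
open MeasureTheory ProbabilityTheory
open scoped BigOperators RealInnerProductSpace ENNReal

noncomputable section

theorem card_mul_sum_norm_sq_sum_apply {ι E : Type*} [Fintype ι] [NormedAddCommGroup E]
    [InnerProductSpace ℝ E] (D : ι → E) (hD : ∑ q, D q = 0) (A : ℕ) :
    (Fintype.card ι : ℝ) * ∑ c : Fin A → ι, ‖∑ l, D (c l)‖ ^ 2
      = A * (Fintype.card ι : ℝ) ^ A * ∑ q, ‖D q‖ ^ 2 := by
  induction A with
  | zero => simp
  | succ A ih =>
    have hsplit : ∑ c : Fin (A + 1) → ι, ‖∑ l, D (c l)‖ ^ 2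
        = ∑ p : ι × (Fin A → ι), ‖D p.1 + ∑ l, D (p.2 l)‖ ^ 2 := by
      refine (Fintype.sum_equiv (Fin.consEquiv fun _ => ι) _ _ fun p => ?_).symm
      simp [Fin.consEquiv, Fin.sum_univ_succ]
    have hcross (c : Fin A → ι) : ∑ q, ⟪D q, ∑ l, D (c l)⟫ = 0 := by
      rw [← sum_inner, hD, inner_zero_left]
    have hexpand : ∑ c : Fin (A + 1) → ι, ‖∑ l, D (c l)‖ ^ 2
        = (Fintype.card ι : ℝ) ^ A * ∑ q, ‖D q‖ ^ 2
          + Fintype.card ι * ∑ c : Fin A → ι, ‖∑ l, D (c l)‖ ^ 2 := by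
      rw [hsplit, Fintype.sum_prod_type_right]
      simp_rw [norm_add_sq_real, Finset.sum_add_distrib, ← Finset.mul_sum, hcross]
      simp [← Finset.mul_sum]
    rw [hexpand, ih]
    push_cast
    ring

theorem integral_apply_le_of_uniform_index {Ω T S F : Type*} [MeasurableSpace Ω]
    {μ : Measure Ω} [Fintype T] [MeasurableSpace S] [MeasurableSingletonClass S]
    [MeasurableSpace F] {I : Ω → T} {Z : Ω → F} {e : T → S} (he : Function.Injective e)
    (hI : Measurable fun ω => e (I ω)) (hZ : AEMeasurable Z μ)
    (hindep : IndepFun (fun ω => e (I ω)) Z μ) {w : ℝ} (hw : 0 < w)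
    (hunif : ∀ t, μ.real {ω | I ω = t} = w) {Φ : T → F → ℝ} (hΦ : ∀ t, Measurable (Φ t))
    (hΦ_nonneg : ∀ t z, 0 ≤ Φ t z) {R : F → ℝ} (hR : Integrable (fun ω => R (Z ω)) μ)
    (hle : ∀ z, w * ∑ t, Φ t z ≤ R z) :
    ∫ ω, Φ (I ω) (Z ω) ∂μ ≤ ∫ ω, R (Z ω) ∂μ := by
  classical
  have hset (t : T) : {ω | I ω = t} = (fun ω => e (I ω)) ⁻¹' {e t} := by
    ext ω
    simp [he.eq_iff]
  have hmeas (t : T) : MeasurableSet {ω | I ω = t} := by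
    rw [hset]
    exact hI (measurableSet_singleton _)
  have haesm (t : T) : AEStronglyMeasurable (fun ω => Φ t (Z ω)) μ :=
    ((hΦ t).comp_aemeasurable hZ).aestronglyMeasurable
  have hint (t : T) : Integrable (fun ω => Φ t (Z ω)) μ := by
    refine (hR.const_mul w⁻¹).mono' (haesm t) (ae_of_all _ fun ω => ?_)
    rw [Real.norm_of_nonneg (hΦ_nonneg _ _), ← div_eq_inv_mul, le_div_iff₀' hw]
    refine le_trans ?_ (hle (Z ω))
    gcongr
    exact Finset.single_le_sum (f := fun t => Φ t (Z ω)) (fun t _ => hΦ_nonneg t _)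
      (Finset.mem_univ t)
  have hterm (t : T) :
      ∫ ω, ({ω | I ω = t}.indicator 1 ω : ℝ) * Φ t (Z ω) ∂μ = w * ∫ ω, Φ t (Z ω) ∂μ := by
    have h := hindep.comp (φ := ({e t} : Set S).indicator (1 : S → ℝ)) (ψ := Φ t)
      (measurable_one.indicator (measurableSet_singleton _)) (hΦ t)
    have hcomp : ({e t} : Set S).indicator (1 : S → ℝ) ∘ (fun ω => e (I ω))
        = {ω | I ω = t}.indicator 1 := by
      rw [hset]
      rfl
    rw [hcomp] at h
    have h' := h.integral_fun_mul_eq_mul_integral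
      (measurable_one.indicator (hmeas t)).aestronglyMeasurable (haesm t)
    rw [integral_indicator_one (hmeas t), hunif] at h'
    exact h'
  have hintegrable (t : T) :
      Integrable (fun ω => ({ω | I ω = t}.indicator 1 ω : ℝ) * Φ t (Z ω)) μ := by
    refine (hint t).mono
      ((measurable_one.indicator (hmeas t)).aestronglyMeasurable.mul (haesm t))
      (ae_of_all _ fun ω => ?_)
    by_cases h : I ω = t <;> simp [h]
  calc ∫ ω, Φ (I ω) (Z ω) ∂μ
      = ∫ ω, ∑ t, ({ω | I ω = t}.indicator 1 ω : ℝ) * Φ t (Z ω) ∂μ := by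
        refine integral_congr_ae (ae_of_all _ fun ω => ?_)
        simp [Set.indicator_apply]
    _ = ∑ t, w * ∫ ω, Φ t (Z ω) ∂μ := by
        rw [integral_finsetSum _ fun t _ => hintegrable t]
        simp_rw [hterm]
    _ = ∫ ω, w * ∑ t, Φ t (Z ω) ∂μ := by
        rw [integral_const_mul, integral_finsetSum _ fun t _ => hint t, Finset.mul_sum]
    _ ≤ ∫ ω, R (Z ω) ∂μ :=
        integral_mono ((integrable_finsetSum _ fun t _ => hint t).const_mul w) hR
          fun ω => hle (Z ω)

/-- Joint law of mutually independent uniform indices, encoded as one family of naturals. -/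
theorem measureReal_index_eq {Ω : Type*} [MeasurableSpace Ω] {μ : Measure Ω} {A m n : ℕ}
    {a : Fin A → Ω → Fin m} {i : Ω → Fin n} {j : Ω → Fin m}
    (ha : ∀ l c, μ {ω | a l ω = c} = (m : ℝ≥0∞)⁻¹) (hi : ∀ c, μ {ω | i ω = c} = (n : ℝ≥0∞)⁻¹)
    (hj : ∀ c, μ {ω | j ω = c} = (m : ℝ≥0∞)⁻¹)
    (hindep : iIndepFun (m := fun _ : Fin (A + 2) => (inferInstance : MeasurableSpace ℕ))
      (fun k : Fin (A + 2) => fun ω =>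
      if h : (k : ℕ) < A then ((a ⟨(k : ℕ), h⟩ ω : ℕ))
      else if (k : ℕ) = A then ((i ω : ℕ)) else ((j ω : ℕ))) μ)
    (t : (Fin A → Fin m) × Fin n × Fin m) :
    μ.real {ω | ((fun l => a l ω, i ω, j ω) : (Fin A → Fin m) × Fin n × Fin m) = t}
      = ((m : ℝ) ^ A * n * m)⁻¹ := by
  obtain ⟨c, p, q⟩ := t
  have h := hindep.measure_inter_preimage_eq_mul Finset.univ
    (sets := fun k : Fin (A + 2) => {if h : (k : ℕ) < A then ((c ⟨(k : ℕ), h⟩ : ℕ))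
      else if (k : ℕ) = A then (p : ℕ) else (q : ℕ)}) (fun _ _ => measurableSet_singleton _)
  have hset : {ω | ((fun l => a l ω, i ω, j ω) : (Fin A → Fin m) × Fin n × Fin m) = (c, p, q)}
      = ⋂ k ∈ (Finset.univ : Finset (Fin (A + 2))), (fun ω =>
        if h : (k : ℕ) < A then ((a ⟨(k : ℕ), h⟩ ω : ℕ))
        else if (k : ℕ) = A then ((i ω : ℕ)) else ((j ω : ℕ))) ⁻¹'
        {if h : (k : ℕ) < A then ((c ⟨(k : ℕ), h⟩ : ℕ))
          else if (k : ℕ) = A then (p : ℕ) else (q : ℕ)} := by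
    ext ω
    simp [Fin.forall_fin_succ', Fin.val_inj, funext_iff, and_assoc]
  rw [measureReal_def, hset, h]
  simp [Fin.prod_univ_castSucc, Set.preimage, Fin.val_inj, ha, hi, hj, mul_comm]

/-- Two index tuples with the same encoding as a family of naturals coincide. -/
theorem index_encoding_injective (A m n : ℕ) :
    Function.Injective fun (t : (Fin A → Fin m) × Fin n × Fin m) (k : Fin (A + 2)) =>
      if h : (k : ℕ) < A then (t.1 ⟨(k : ℕ), h⟩ : ℕ)
      else if (k : ℕ) = A then (t.2.1 : ℕ) else (t.2.2 : ℕ) := by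
  rintro ⟨c, p, q⟩ ⟨c', p', q'⟩ h
  simpa [Fin.forall_fin_succ', Fin.val_inj, funext_iff, and_assoc] using h

theorem norm_sub_smul_add_sq_le {E : Type*} [NormedAddCommGroup E] [InnerProductSpace ℝ E]
    {γ μf : ℝ} (hγ : 0 < γ) (hμf : 0 < μf) (y P Q : E) :
    ‖y - γ • (P + Q)‖ ^ 2 ≤ (1 + μf * γ / 4) * ‖y‖ ^ 2 + (16 * γ / μf + 4 * γ ^ 2) * ‖P‖ ^ 2
      - 2 * γ * ⟪Q, y⟫ + 15 / 8 * γ ^ 2 * ‖Q‖ ^ 2 := by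
  have hsq : ‖P + Q‖ ^ 2 ≤ 4 * ‖P‖ ^ 2 + 15 / 8 * ‖Q‖ ^ 2 := by
    have h : ‖P + Q‖ ^ 2 ≤ (‖P‖ + ‖Q‖) ^ 2 := by gcongr; exact norm_add_le P Q
    nlinarith [sq_nonneg (8 * ‖P‖ - 7 * ‖Q‖), sq_nonneg ‖P‖]
  have hinner : -(2 * γ * ⟪P, y⟫) ≤ μf * γ / 4 * ‖y‖ ^ 2 + 16 * γ / μf * ‖P‖ ^ 2 := by
    have h₁ : -⟪P, y⟫ ≤ ‖P‖ * ‖y‖ := (neg_le_abs _).trans (abs_real_inner_le_norm P y)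
    have h₂ : μf * γ / 4 * ‖y‖ ^ 2 + 16 * γ / μf * ‖P‖ ^ 2 - 2 * γ * (‖P‖ * ‖y‖)
        = γ / (4 * μf) * ((μf * ‖y‖ - 4 * ‖P‖) ^ 2 + 48 * ‖P‖ ^ 2) := by
      field_simp
      ring
    have h₃ : 0 ≤ γ / (4 * μf) * ((μf * ‖y‖ - 4 * ‖P‖) ^ 2 + 48 * ‖P‖ ^ 2) := by positivity
    nlinarith
  have hexpand : ‖y - γ • (P + Q)‖ ^ 2
      = ‖y‖ ^ 2 - 2 * γ * ⟪P, y⟫ - 2 * γ * ⟪Q, y⟫ + γ ^ 2 * ‖P + Q‖ ^ 2 := by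
    rw [norm_sub_sq_real, inner_smul_right, inner_add_right, norm_smul, mul_pow,
      Real.norm_eq_abs, sq_abs, real_inner_comm P y, real_inner_comm Q y]
    ring
  have hscaled := mul_le_mul_of_nonneg_left hsq (sq_nonneg γ)
  rw [hexpand]
  linarith

/-- A strong-convexity lower bound forces the (Lipschitz) gradient map to vanish at a minimizer. -/
theorem gradient_eq_zero_of_isMin {E : Type*} [NormedAddCommGroup E] [InnerProductSpace ℝ E]
    {f : E → ℝ} {g : E → E} {L : ℝ} (hL : 0 < L) (hg : ∀ x y, ‖g x - g y‖ ≤ L * ‖x - y‖)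
    (hf : ∀ x y, f x + ⟪g x, y - x⟫ ≤ f y) {x₀ : E} (hmin : ∀ x, f x₀ ≤ f x) : g x₀ = 0 := by
  set t : ℝ := (2 * L)⁻¹ with ht
  have ht_pos : 0 < t := by positivity
  set z := x₀ - t • g x₀ with hz
  have hdiff : x₀ - z = t • g x₀ := by rw [hz]; abel
  have h₁ : ⟪g z, g x₀⟫ ≤ 0 := by
    have h := hf z x₀
    rw [hdiff, inner_smul_right] at h
    have h' : t * ⟪g z, g x₀⟫ ≤ 0 := by linarith [hmin z]
    exact nonpos_of_mul_nonpos_right h' ht_pos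
  have h₂ : ⟪g x₀ - g z, g x₀⟫ ≤ 1 / 2 * ‖g x₀‖ ^ 2 := by
    calc ⟪g x₀ - g z, g x₀⟫ ≤ ‖g x₀ - g z‖ * ‖g x₀‖ := real_inner_le_norm _ _
      _ ≤ L * ‖x₀ - z‖ * ‖g x₀‖ := by gcongr; exact hg x₀ z
      _ = 1 / 2 * ‖g x₀‖ ^ 2 := by
        rw [hdiff, norm_smul, Real.norm_of_nonneg ht_pos.le, ht]
        field_simp
  rw [inner_sub_left, real_inner_self_eq_norm_sq] at h₂
  have : ‖g x₀‖ ^ 2 = 0 := le_antisymm (by linarith) (sq_nonneg _)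
  simpa using this

theorem smul_gradf_eq_sum {N M m n : ℕ} (hm : 0 < m) (hn : 0 < n)
    (Gc : Fin m → EuclideanSpace ℝ (Fin N) → EuclideanSpace ℝ (Fin M))
    (DG : Fin m → EuclideanSpace ℝ (Fin N) →
      (EuclideanSpace ℝ (Fin N) →L[ℝ] EuclideanSpace ℝ (Fin M)))
    (gF : Fin n → EuclideanSpace ℝ (Fin M) → EuclideanSpace ℝ (Fin M))
    (x : EuclideanSpace ℝ (Fin N)) :
    ((n : ℝ) * m) • gradf Gc DG gF x
      = ∑ p, ∑ q, ContinuousLinearMap.adjoint (DG q x) (gF p (Gbar Gc x)) := by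
  have hm' : (m : ℝ) ≠ 0 := by positivity
  have hn' : (n : ℝ) ≠ 0 := by positivity
  simp only [gradf, DGbar, gradFbar, map_smulₛₗ, map_sum, smul_apply, sum_apply,
    smul_smul, ← Finset.smul_sum, conj_trivial, RingHom.id_apply]
  rw [show (n : ℝ) * m * ((n : ℝ)⁻¹ * (m : ℝ)⁻¹) = 1 by field_simp, one_smul]

theorem norm_gradf_sub_le {N M m n : ℕ} (hm : 0 < m) (hn : 0 < n)
    {Gc : Fin m → EuclideanSpace ℝ (Fin N) → EuclideanSpace ℝ (Fin M)}
    {DG : Fin m → EuclideanSpace ℝ (Fin N) →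
      (EuclideanSpace ℝ (Fin N) →L[ℝ] EuclideanSpace ℝ (Fin M))}
    {gF : Fin n → EuclideanSpace ℝ (Fin M) → EuclideanSpace ℝ (Fin M)} {Lf : ℝ}
    (hLf : ∀ (x y : EuclideanSpace ℝ (Fin N)) (i : Fin n) (j : Fin m),
      ‖ContinuousLinearMap.adjoint (DG j x) (gF i (Gbar Gc x))
        - ContinuousLinearMap.adjoint (DG j y) (gF i (Gbar Gc y))‖ ≤ Lf * ‖x - y‖)
    (x y : EuclideanSpace ℝ (Fin N)) :
    ‖gradf Gc DG gF x - gradf Gc DG gF y‖ ≤ Lf * ‖x - y‖ := by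
  have hnm : 0 < (n : ℝ) * m := by positivity
  refine le_of_mul_le_mul_left ?_ hnm
  calc (n : ℝ) * m * ‖gradf Gc DG gF x - gradf Gc DG gF y‖
      = ‖∑ p, ∑ q, (ContinuousLinearMap.adjoint (DG q x) (gF p (Gbar Gc x))
          - ContinuousLinearMap.adjoint (DG q y) (gF p (Gbar Gc y)))‖ := by
        simp_rw [Finset.sum_sub_distrib]
        rw [← smul_gradf_eq_sum hm hn, ← smul_gradf_eq_sum hm hn, ← smul_sub, norm_smul,
          Real.norm_of_nonneg hnm.le]
    _ ≤ ∑ _p : Fin n, ∑ _q : Fin m, Lf * ‖x - y‖ :=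
        norm_sum_le_of_le _ fun p _ => norm_sum_le_of_le _ fun q _ => hLf x y p q
    _ = (n : ℝ) * m * (Lf * ‖x - y‖) := by simp [mul_assoc]

/-- Second moment of the mini-batch estimation error of `G(x)` with anchor point `xt`. -/
theorem sum_norm_minibatch_error_sq_le {N M m : ℕ} (hm : 0 < m)
    {Gc : Fin m → EuclideanSpace ℝ (Fin N) → EuclideanSpace ℝ (Fin M)} {B : ℝ}
    (hGc : ∀ j u v, ‖Gc j u - Gc j v‖ ≤ B * ‖u - v‖) {A : ℕ} (hA : 1 ≤ A)
    (xt x : EuclideanSpace ℝ (Fin N)) :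
    ∑ c : Fin A → Fin m, ‖Gbar Gc xt - (A : ℝ)⁻¹ • ∑ l, (Gc (c l) xt - Gc (c l) x)
        - Gbar Gc x‖ ^ 2 ≤ (m : ℝ) ^ A * (4 * B ^ 2 / A * ‖xt - x‖ ^ 2) := by
  have hm' : (0 : ℝ) < m := by positivity
  have hA' : (0 : ℝ) < A := by positivity
  have hbar (u : EuclideanSpace ℝ (Fin N)) : (m : ℝ) • Gbar Gc u = ∑ q, Gc q u := by
    rw [Gbar, smul_inv_smul₀ hm'.ne']
  set Y : EuclideanSpace ℝ (Fin M) := Gbar Gc xt - Gbar Gc x with hY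
  set D : Fin m → EuclideanSpace ℝ (Fin M) := fun q => Y - (Gc q xt - Gc q x) with hD
  have hD_sum : ∑ q, D q = 0 := by
    simp only [hD, Finset.sum_sub_distrib, Finset.sum_const, Finset.card_univ, Fintype.card_fin,
      ← hbar, ← Nat.cast_smul_eq_nsmul ℝ, hY, sub_self]
  have hY_norm : ‖Y‖ ≤ B * ‖xt - x‖ := by
    refine le_of_mul_le_mul_left ?_ hm'
    calc (m : ℝ) * ‖Y‖ = ‖∑ q, (Gc q xt - Gc q x)‖ := by
          rw [Finset.sum_sub_distrib, ← hbar, ← hbar, ← smul_sub, norm_smul,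
            Real.norm_of_nonneg hm'.le]
      _ ≤ ∑ _q : Fin m, B * ‖xt - x‖ := norm_sum_le_of_le _ fun q _ => hGc q xt x
      _ = m * (B * ‖xt - x‖) := by simp
  have hD_norm (q : Fin m) : ‖D q‖ ^ 2 ≤ 4 * B ^ 2 * ‖xt - x‖ ^ 2 := by
    have h : ‖D q‖ ≤ 2 * B * ‖xt - x‖ := by
      linarith [norm_sub_le Y (Gc q xt - Gc q x), hGc q xt x]
    calc ‖D q‖ ^ 2 ≤ (2 * B * ‖xt - x‖) ^ 2 := by gcongr
      _ = 4 * B ^ 2 * ‖xt - x‖ ^ 2 := by ring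
  have herr (c : Fin A → Fin m) :
      ‖Gbar Gc xt - (A : ℝ)⁻¹ • ∑ l, (Gc (c l) xt - Gc (c l) x) - Gbar Gc x‖ ^ 2
        = ((A : ℝ) ^ 2)⁻¹ * ‖∑ l, D (c l)‖ ^ 2 := by
    have h : Gbar Gc xt - (A : ℝ)⁻¹ • ∑ l, (Gc (c l) xt - Gc (c l) x) - Gbar Gc x
        = (A : ℝ)⁻¹ • ∑ l, D (c l) := by
      simp only [hD]
      rw [Finset.sum_sub_distrib (f := fun _ => Y), smul_sub, Finset.sum_const, Finset.card_univ,
        Fintype.card_fin, ← Nat.cast_smul_eq_nsmul ℝ, inv_smul_smul₀ hA'.ne', hY]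
      abel
    rw [h, norm_smul, mul_pow, norm_inv, Real.norm_of_nonneg hA'.le, inv_pow]
  have hmoment := card_mul_sum_norm_sq_sum_apply D hD_sum A
  rw [Fintype.card_fin] at hmoment
  have hsum : ∑ q, ‖D q‖ ^ 2 ≤ m * (4 * B ^ 2 * ‖xt - x‖ ^ 2) := by
    simpa using Finset.sum_le_sum fun q (_ : q ∈ Finset.univ) => hD_norm q
  simp_rw [herr]
  rw [← Finset.mul_sum]
  refine le_of_mul_le_mul_left ?_ hm'
  calc (m : ℝ) * (((A : ℝ) ^ 2)⁻¹ * ∑ c : Fin A → Fin m, ‖∑ l, D (c l)‖ ^ 2)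
      = ((A : ℝ) ^ 2)⁻¹ * (A * (m : ℝ) ^ A * ∑ q, ‖D q‖ ^ 2) := by rw [← hmoment]; ring
    _ ≤ ((A : ℝ) ^ 2)⁻¹ * (A * (m : ℝ) ^ A * (m * (4 * B ^ 2 * ‖xt - x‖ ^ 2))) := by gcongr
    _ = m * ((m : ℝ) ^ A * (4 * B ^ 2 / A * ‖xt - x‖ ^ 2)) := by
        field_simp

/-- The Compositional-SVRG-1 step from `x` with anchor `xt` and sampled indices
`t = (a₁, …, a_A; i; j)`. -/
def svrgStep {N M m n A : ℕ} (Gc : Fin m → EuclideanSpace ℝ (Fin N) → EuclideanSpace ℝ (Fin M))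
    (DG : Fin m → EuclideanSpace ℝ (Fin N) →
      (EuclideanSpace ℝ (Fin N) →L[ℝ] EuclideanSpace ℝ (Fin M)))
    (gF : Fin n → EuclideanSpace ℝ (Fin M) → EuclideanSpace ℝ (Fin M)) (γ : ℝ)
    (t : (Fin A → Fin m) × Fin n × Fin m) (xt x : EuclideanSpace ℝ (Fin N)) :
    EuclideanSpace ℝ (Fin N) :=
  x - γ • (ContinuousLinearMap.adjoint (DG t.2.2 x) (gF t.2.1
      (Gbar Gc xt - (A : ℝ)⁻¹ • ∑ l : Fin A, (Gc (t.1 l) xt - Gc (t.1 l) x)))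
    - ContinuousLinearMap.adjoint (DG t.2.2 xt) (gF t.2.1 (Gbar Gc xt)) + gradf Gc DG gF xt)

theorem continuous_svrgStep {N M m n A : ℕ}
    {Gc : Fin m → EuclideanSpace ℝ (Fin N) → EuclideanSpace ℝ (Fin M)}
    {DG : Fin m → EuclideanSpace ℝ (Fin N) →
      (EuclideanSpace ℝ (Fin N) →L[ℝ] EuclideanSpace ℝ (Fin M))}
    {gF : Fin n → EuclideanSpace ℝ (Fin M) → EuclideanSpace ℝ (Fin M)}
    (hGc : ∀ j, Continuous (Gc j)) (hDG : ∀ j, Continuous (DG j)) (hgF : ∀ i, Continuous (gF i))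
    (γ : ℝ) (t : (Fin A → Fin m) × Fin n × Fin m) :
    Continuous fun z : EuclideanSpace ℝ (Fin N) × EuclideanSpace ℝ (Fin N) =>
      svrgStep Gc DG gF γ t z.1 z.2 := by
  have hadj (q : Fin m) : Continuous fun u => ContinuousLinearMap.adjoint (DG q u) :=
    ContinuousLinearMap.adjoint.continuous.comp (hDG q)
  unfold svrgStep gradf DGbar gradFbar Gbar
  have hbar : Continuous fun u => ContinuousLinearMap.adjoint ((m : ℝ)⁻¹ • ∑ q, DG q u) :=
    ContinuousLinearMap.adjoint.continuous.comp (by fun_prop)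
  fun_prop

/-- Average over the sampled indices of the squared distance to the minimizer after one step. -/
theorem sum_norm_svrgStep_sub_sq_le {N M m n A : ℕ} (hm : 0 < m) (hn : 0 < n) (hA : 1 ≤ A)
    {Gc : Fin m → EuclideanSpace ℝ (Fin N) → EuclideanSpace ℝ (Fin M)}
    {DG : Fin m → EuclideanSpace ℝ (Fin N) →
      (EuclideanSpace ℝ (Fin N) →L[ℝ] EuclideanSpace ℝ (Fin M))}
    {gF : Fin n → EuclideanSpace ℝ (Fin M) → EuclideanSpace ℝ (Fin M)} {B LF Lf μf γ : ℝ}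
    (hB : 0 < B) (hLF : 0 < LF) (hLf : 0 < Lf) (hμf : 0 < μf) (hγ : 0 < γ)
    (hGc : ∀ j u v, ‖Gc j u - Gc j v‖ ≤ B * ‖u - v‖) (hDG : ∀ j u, ‖DG j u‖ ≤ B)
    (hgF : ∀ i u v, ‖gF i u - gF i v‖ ≤ LF * ‖u - v‖)
    (hgrad : ∀ (x y : EuclideanSpace ℝ (Fin N)) (i : Fin n) (j : Fin m),
      ‖ContinuousLinearMap.adjoint (DG j x) (gF i (Gbar Gc x))
        - ContinuousLinearMap.adjoint (DG j y) (gF i (Gbar Gc y))‖ ≤ Lf * ‖x - y‖)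
    {xstar : EuclideanSpace ℝ (Fin N)} (hzero : gradf Gc DG gF xstar = 0)
    (hmono : ∀ x, μf * ‖x - xstar‖ ^ 2 ≤ ⟪gradf Gc DG gF x, x - xstar⟫)
    (xt x : EuclideanSpace ℝ (Fin N)) :
    ∑ t : (Fin A → Fin m) × Fin n × Fin m, ‖svrgStep Gc DG gF γ t xt x - xstar‖ ^ 2
      ≤ (m : ℝ) ^ A * n * m * ((1 - 7 * μf * γ / 4
            + (16 * γ * B ^ 2 * LF ^ 2 / μf + 4 * γ ^ 2 * B ^ 2 * LF ^ 2) * (8 * B ^ 2 / (A : ℝ))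
            + 8 * γ ^ 2 * Lf ^ 2) * ‖x - xstar‖ ^ 2
        + ((16 * γ * B ^ 2 * LF ^ 2 / μf + 4 * γ ^ 2 * B ^ 2 * LF ^ 2) * (8 * B ^ 2 / (A : ℝ))
            + 10 * γ ^ 2 * Lf ^ 2) * ‖xt - xstar‖ ^ 2) := by
  set y := x - xstar with hy
  set yt := xt - xstar with hyt
  set K : ℝ := 16 * γ / μf + 4 * γ ^ 2 with hK
  have hK_pos : 0 < K := by positivity
  have hsub : xt - x = yt - y := by rw [hy, hyt]; abel
  have hdist : ‖xt - x‖ ^ 2 ≤ 2 * (‖y‖ ^ 2 + ‖yt‖ ^ 2) := by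
    have h : ‖xt - x‖ ^ 2 ≤ (‖yt‖ + ‖y‖) ^ 2 := by rw [hsub]; gcongr; exact norm_sub_le _ _
    nlinarith [sq_nonneg (‖yt‖ - ‖y‖)]
  set err : (Fin A → Fin m) → EuclideanSpace ℝ (Fin M) := fun c =>
    Gbar Gc xt - (A : ℝ)⁻¹ • ∑ l : Fin A, (Gc (c l) xt - Gc (c l) x) - Gbar Gc x with herr
  set g : Fin n → Fin m → EuclideanSpace ℝ (Fin N) → EuclideanSpace ℝ (Fin N) := fun p q u =>
    ContinuousLinearMap.adjoint (DG q u) (gF p (Gbar Gc u)) with hg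
  set Q : Fin n → Fin m → EuclideanSpace ℝ (Fin N) := fun p q =>
    g p q x - g p q xt + gradf Gc DG gF xt with hQ
  have hQ_norm (p : Fin n) (q : Fin m) :
      15 / 8 * ‖Q p q‖ ^ 2 ≤ Lf ^ 2 * (8 * ‖y‖ ^ 2 + 10 * ‖yt‖ ^ 2) := by
    have h₁ : ‖g p q x - g p q xt‖ ≤ Lf * (‖y‖ + ‖yt‖) := by
      refine (hgrad x xt p q).trans ?_
      rw [norm_sub_rev, hsub, add_comm]
      gcongr
      exact norm_sub_le _ _
    have h₂ : ‖gradf Gc DG gF xt‖ ≤ Lf * ‖yt‖ := by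
      simpa [hzero] using norm_gradf_sub_le hm hn hgrad xt xstar
    have h₃ : ‖Q p q‖ ≤ Lf * (‖y‖ + 2 * ‖yt‖) := by
      refine (norm_add_le _ _).trans ?_
      linarith
    calc 15 / 8 * ‖Q p q‖ ^ 2 ≤ 15 / 8 * (Lf * (‖y‖ + 2 * ‖yt‖)) ^ 2 := by gcongr
      _ = Lf ^ 2 * (15 / 8 * (‖y‖ + 2 * ‖yt‖) ^ 2) := by ring
      _ ≤ Lf ^ 2 * (8 * ‖y‖ ^ 2 + 10 * ‖yt‖ ^ 2) := by
        gcongr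
        nlinarith [sq_nonneg (3 * ‖y‖ - 2 * ‖yt‖), sq_nonneg ‖y‖]
  have hterm (c : Fin A → Fin m) (p : Fin n) (q : Fin m) :
      ‖svrgStep Gc DG gF γ (c, p, q) xt x - xstar‖ ^ 2
        ≤ K * (B * LF) ^ 2 * ‖err c‖ ^ 2 + ((1 + μf * γ / 4) * ‖y‖ ^ 2
          + γ ^ 2 * (Lf ^ 2 * (8 * ‖y‖ ^ 2 + 10 * ‖yt‖ ^ 2)) - 2 * γ * ⟪Q p q, y⟫) := by
    set P : EuclideanSpace ℝ (Fin N) := ContinuousLinearMap.adjoint (DG q x) (gF p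
      (Gbar Gc xt - (A : ℝ)⁻¹ • ∑ l : Fin A, (Gc (c l) xt - Gc (c l) x)) - gF p (Gbar Gc x))
      with hP
    have hstep : svrgStep Gc DG gF γ (c, p, q) xt x - xstar = y - γ • (P + Q p q) := by
      simp only [svrgStep, hP, hQ, hg, map_sub, hy]
      have h (u v w z : EuclideanSpace ℝ (Fin N)) : u - v + (v - w + z) = u - w + z := by abel
      rw [h]
      abel
    have hP_norm : ‖P‖ ≤ B * (LF * ‖err c‖) := by
      refine (ContinuousLinearMap.le_opNorm _ _).trans ?_
      rw [LinearIsometryEquiv.norm_map]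
      gcongr
      · exact hDG q x
      · exact hgF p _ _
    have hP_sq : K * ‖P‖ ^ 2 ≤ K * (B * LF) ^ 2 * ‖err c‖ ^ 2 := by
      calc K * ‖P‖ ^ 2 ≤ K * (B * (LF * ‖err c‖)) ^ 2 := by gcongr
        _ = K * (B * LF) ^ 2 * ‖err c‖ ^ 2 := by ring
    have hQ_sq := mul_le_mul_of_nonneg_left (hQ_norm p q) (sq_nonneg γ)
    rw [hstep]
    linarith [norm_sub_smul_add_sq_le hγ hμf y P (Q p q)]
  have hQ_inner : (n : ℝ) * m * (μf * ‖y‖ ^ 2) ≤ ∑ p, ∑ q, ⟪Q p q, y⟫ := by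
    have hQ_sum : ∑ p, ∑ q, Q p q = ((n : ℝ) * m) • gradf Gc DG gF x := by
      simp only [hQ, hg, Finset.sum_add_distrib, Finset.sum_sub_distrib]
      rw [← smul_gradf_eq_sum hm hn, ← smul_gradf_eq_sum hm hn]
      simp [← Nat.cast_smul_eq_nsmul ℝ, smul_smul]
    simp_rw [← sum_inner]
    rw [hQ_sum, real_inner_smul_left]
    gcongr
    exact hmono x
  have herr_sum : ∑ c, ‖err c‖ ^ 2 ≤ (m : ℝ) ^ A * (8 * B ^ 2 / A * (‖y‖ ^ 2 + ‖yt‖ ^ 2)) := by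
    refine (sum_norm_minibatch_error_sq_le hm hGc hA xt x).trans ?_
    calc (m : ℝ) ^ A * (4 * B ^ 2 / A * ‖xt - x‖ ^ 2)
        ≤ (m : ℝ) ^ A * (4 * B ^ 2 / A * (2 * (‖y‖ ^ 2 + ‖yt‖ ^ 2))) := by gcongr
      _ = _ := by ring
  set R : ℝ := (1 + μf * γ / 4) * ‖y‖ ^ 2
    + γ ^ 2 * (Lf ^ 2 * (8 * ‖y‖ ^ 2 + 10 * ‖yt‖ ^ 2)) with hR
  calc ∑ t : (Fin A → Fin m) × Fin n × Fin m, ‖svrgStep Gc DG gF γ t xt x - xstar‖ ^ 2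
      ≤ ∑ c, ∑ p, ∑ q, (K * (B * LF) ^ 2 * ‖err c‖ ^ 2 + (R - 2 * γ * ⟪Q p q, y⟫)) := by
        simp_rw [Fintype.sum_prod_type]
        exact Finset.sum_le_sum fun c _ => Finset.sum_le_sum fun p _ =>
          Finset.sum_le_sum fun q _ => hterm c p q
    _ = (n : ℝ) * m * (K * (B * LF) ^ 2) * ∑ c, ‖err c‖ ^ 2
        + (m : ℝ) ^ A * ((n : ℝ) * m * R - 2 * γ * ∑ p, ∑ q, ⟪Q p q, y⟫) := by
        simp only [Finset.sum_add_distrib, Finset.sum_sub_distrib, ← Finset.mul_sum,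
          Finset.sum_const, Finset.card_univ, Fintype.card_fin, Fintype.card_pi,
          Finset.prod_const, nsmul_eq_mul, Nat.cast_pow]
        ring
    _ ≤ (n : ℝ) * m * (K * (B * LF) ^ 2) *
          ((m : ℝ) ^ A * (8 * B ^ 2 / A * (‖y‖ ^ 2 + ‖yt‖ ^ 2)))
        + (m : ℝ) ^ A * ((n : ℝ) * m * R - 2 * γ * ((n : ℝ) * m * (μf * ‖y‖ ^ 2))) := by
        gcongr
    _ = _ := by
        rw [hR, hK]
        ring

/-- One-step recurrence for Compositional-SVRG-1. -/
theorem stmt7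
    (N M m n : ℕ) (hN : 0 < N) (hM : 0 < M) (hm : 0 < m) (hn : 0 < n)
    (Gc : Fin m → EuclideanSpace ℝ (Fin N) → EuclideanSpace ℝ (Fin M))
    (DG : Fin m → EuclideanSpace ℝ (Fin N) → (EuclideanSpace ℝ (Fin N) →L[ℝ] EuclideanSpace ℝ (Fin M)))
    (hGc : ∀ j, ContDiff ℝ 1 (Gc j))
    (hDG : ∀ (j : Fin m) (x : EuclideanSpace ℝ (Fin N)), HasFDerivAt (Gc j) (DG j x) x)
    (Fc : Fin n → EuclideanSpace ℝ (Fin M) → ℝ)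
    (gF : Fin n → EuclideanSpace ℝ (Fin M) → EuclideanSpace ℝ (Fin M))
    (hFc : ∀ i, ContDiff ℝ 1 (Fc i))
    (hgF : ∀ (i : Fin n) (y : EuclideanSpace ℝ (Fin M)), HasGradientAt (Fc i) (gF i y) y)
    (BG : ℝ) (hBG : 0 < BG)
    (hBGb : ∀ (j : Fin m) (x : EuclideanSpace ℝ (Fin N)), ‖DG j x‖ ≤ BG)
    (LF : ℝ) (hLF : 0 < LF)
    (hLFb : ∀ (i : Fin n) (u v : EuclideanSpace ℝ (Fin M)), ‖gF i u - gF i v‖ ≤ LF * ‖u - v‖)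
    (Lf : ℝ) (hLf : 0 < Lf)
    (hLfb : ∀ (x y : EuclideanSpace ℝ (Fin N)) (i : Fin n) (j : Fin m),
      ‖ContinuousLinearMap.adjoint (DG j x) (gF i (Gbar Gc x))
        - ContinuousLinearMap.adjoint (DG j y) (gF i (Gbar Gc y))‖ ≤ Lf * ‖x - y‖)
    (μf : ℝ) (hμf : 0 < μf)
    (hsc : ∀ x y : EuclideanSpace ℝ (Fin N),
      fObj Gc Fc y ≥ fObj Gc Fc x + ⟪gradf Gc DG gF x, y - x⟫ + μf / 2 * ‖y - x‖ ^ 2)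
    (xstar : EuclideanSpace ℝ (Fin N)) (hxstar : ∀ x, fObj Gc Fc xstar ≤ fObj Gc Fc x)
    (Ω : Type*) [MeasurableSpace Ω] (μ : Measure Ω) [IsProbabilityMeasure μ]
    (γ : ℝ) (hγ : 0 < γ) (A : ℕ) (hA : 1 ≤ A)
    (xt x : Ω → EuclideanSpace ℝ (Fin N))
    (hxt : MemLp xt 2 μ) (hx : MemLp x 2 μ)
    (a : Fin A → Ω → Fin m) (i : Ω → Fin n) (j : Ω → Fin m)
    (ha_meas : ∀ l, Measurable (a l)) (hi_meas : Measurable i) (hj_meas : Measurable j)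
    (ha_unif : ∀ (l : Fin A) (c : Fin m), μ {ω | a l ω = c} = (m : ℝ≥0∞)⁻¹)
    (hi_unif : ∀ c : Fin n, μ {ω | i ω = c} = (n : ℝ≥0∞)⁻¹)
    (hj_unif : ∀ c : Fin m, μ {ω | j ω = c} = (m : ℝ≥0∞)⁻¹)
    (hidx_indep : iIndepFun (m := fun _ : Fin (A + 2) => (inferInstance : MeasurableSpace ℕ))
      (fun k : Fin (A + 2) => fun ω =>
      if h : (k : ℕ) < A then ((a ⟨(k : ℕ), h⟩ ω : ℕ))
      else if (k : ℕ) = A then ((i ω : ℕ)) else ((j ω : ℕ))) μ)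
    (hindep : IndepFun
      (fun ω => fun k : Fin (A + 2) =>
        if h : (k : ℕ) < A then ((a ⟨(k : ℕ), h⟩ ω : ℕ))
        else if (k : ℕ) = A then ((i ω : ℕ)) else ((j ω : ℕ)))
      (fun ω => (xt ω, x ω)) μ) :
    ∫ ω, ‖x ω - γ • (ContinuousLinearMap.adjoint (DG (j ω) (x ω)) (gF (i ω)
            (Gbar Gc (xt ω) - (A : ℝ)⁻¹ • ∑ l : Fin A, (Gc (a l ω) (xt ω) - Gc (a l ω) (x ω))))
          - ContinuousLinearMap.adjoint (DG (j ω) (xt ω)) (gF (i ω) (Gbar Gc (xt ω)))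
          + gradf Gc DG gF (xt ω)) - xstar‖ ^ 2 ∂μ
      ≤ (1 - 7 * μf * γ / 4
            + (16 * γ * BG ^ 2 * LF ^ 2 / μf + 4 * γ ^ 2 * BG ^ 2 * LF ^ 2) * (8 * BG ^ 2 / (A : ℝ))
            + 8 * γ ^ 2 * Lf ^ 2) * ∫ ω, ‖x ω - xstar‖ ^ 2 ∂μ
        + ((16 * γ * BG ^ 2 * LF ^ 2 / μf + 4 * γ ^ 2 * BG ^ 2 * LF ^ 2) * (8 * BG ^ 2 / (A : ℝ))
            + 10 * γ ^ 2 * Lf ^ 2) * ∫ ω, ‖xt ω - xstar‖ ^ 2 ∂μ := by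
  have hGc_lip (q : Fin m) (u v : EuclideanSpace ℝ (Fin N)) :
      ‖Gc q u - Gc q v‖ ≤ BG * ‖u - v‖ :=
    convex_univ.norm_image_sub_le_of_norm_hasFDerivWithin_le
      (fun z _ => (hDG q z).hasFDerivWithinAt) (fun z _ => hBGb q z) (Set.mem_univ v)
      (Set.mem_univ u)
  have hDG_cont (q : Fin m) : Continuous (DG q) := by
    rw [show DG q = fderiv ℝ (Gc q) from funext fun z => (hDG q z).fderiv.symm]
    exact (hGc q).continuous_fderiv one_ne_zero
  have hgF_cont (p : Fin n) : Continuous (gF p) :=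
    (LipschitzWith.of_dist_le' (K := LF) fun u v => by
      simpa [dist_eq_norm] using hLFb p u v).continuous
  have hzero : gradf Gc DG gF xstar = 0 :=
    gradient_eq_zero_of_isMin hLf (norm_gradf_sub_le hm hn hLfb)
      (fun u v => by nlinarith [hsc u v, mul_nonneg hμf.le (sq_nonneg ‖v - u‖)]) hxstar
  have hmono (u : EuclideanSpace ℝ (Fin N)) :
      μf * ‖u - xstar‖ ^ 2 ≤ ⟪gradf Gc DG gF u, u - xstar⟫ := by
    have h₁ := hsc u xstar
    have h₂ := hsc xstar u
    rw [hzero, inner_zero_left] at h₂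
    rw [norm_sub_rev, ← neg_sub u xstar, inner_neg_right] at h₁
    linarith
  have hx_int : Integrable (fun ω => ‖x ω - xstar‖ ^ 2) μ :=
    (hx.sub (memLp_const xstar)).integrable_norm_pow two_ne_zero
  have hxt_int : Integrable (fun ω => ‖xt ω - xstar‖ ^ 2) μ :=
    (hxt.sub (memLp_const xstar)).integrable_norm_pow two_ne_zero
  have hW : (0 : ℝ) < (m : ℝ) ^ A * n * m := by positivity
  rw [← integral_const_mul, ← integral_const_mul,
    ← integral_add (hx_int.const_mul _) (hxt_int.const_mul _)]
  refine integral_apply_le_of_uniform_index (index_encoding_injective A m n)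
    (I := fun ω => (fun l => a l ω, i ω, j ω)) (Z := fun ω => (xt ω, x ω))
    (Φ := fun t z => ‖svrgStep Gc DG gF γ t z.1 z.2 - xstar‖ ^ 2)
    (R := fun z => _ * ‖z.2 - xstar‖ ^ 2 + _ * ‖z.1 - xstar‖ ^ 2)
    ?_ (hxt.aemeasurable.prodMk hx.aemeasurable) hindep (inv_pos.2 hW)
    (measureReal_index_eq ha_unif hi_unif hj_unif hidx_indep)
    (fun t => ?_) (fun t z => sq_nonneg _) ((hx_int.const_mul _).add (hxt_int.const_mul _))
    fun z => ?_
  · refine measurable_pi_lambda _ fun k => ?_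
    dsimp only
    split_ifs with h
    · exact (measurable_of_countable _).comp (ha_meas _)
    · exact (measurable_of_countable _).comp hi_meas
    · exact (measurable_of_countable _).comp hj_meas
  · have h := continuous_svrgStep (fun q => (hGc q).continuous) hDG_cont hgF_cont γ t
    exact ((h.sub continuous_const).norm.pow 2).measurable
  · rw [inv_mul_le_iff₀ hW]
    exact sum_norm_svrgStep_sub_sq_le hm hn hA hBG hLF hLf hμf hγ hGc_lip hBGb hLFb hLfb hzero
      hmono z.1 z.2
end
end

section
/- (Corollary 1: linear per-epoch contraction of Compositional-SVRG-1) If the parameters are chosen as γ = μ_f/(32 L_f²), A ≥ 512 B_G⁴ L_F²/μ_f², and K ≥ 512 L_f²/μ_f², then the iterates of one Compositional-SVRG-1 epoch satisfy (1/K) Σ_{k=0}^{K−1} E‖x_k − x*‖² ≤ (7/8) · E‖x̃ − x*‖². -/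
open MeasureTheory ProbabilityTheory
open scoped BigOperators RealInnerProductSpace ENNReal

noncomputable section

/-- The pair `(p, q)` is uniformly distributed on `Fin m × Fin n` and independent of `F`. -/
def UniformPairIndep {Ω : Type*} {m n : ℕ} (F : MeasurableSpace Ω)
    [MeasurableSpace Ω] (μ : Measure Ω) (p : Ω → Fin m) (q : Ω → Fin n) : Prop :=
  ∀ c d S, MeasurableSet[F] S →
    μ (S ∩ {ω | p ω = c ∧ q ω = d}) = (m : ℝ≥0∞)⁻¹ * (n : ℝ≥0∞)⁻¹ * μ S

lemma UniformPairIndep.setIntegral_eq {Ω : Type*} {m n : ℕ} {F : MeasurableSpace Ω}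
    {mΩ : MeasurableSpace Ω} {μ : Measure Ω} (hF : F ≤ mΩ)
    {p : Ω → Fin m} {q : Ω → Fin n} (h : UniformPairIndep F μ p q) (c : Fin m) (d : Fin n)
    {f : Ω → ℝ} (hf : StronglyMeasurable[F] f) :
    ∫ ω in {ω | p ω = c ∧ q ω = d}, f ω ∂μ = (m : ℝ)⁻¹ * (n : ℝ)⁻¹ * ∫ ω, f ω ∂μ := by
  have htrim : (μ.restrict {ω | p ω = c ∧ q ω = d}).trim hF
      = ((m : ℝ≥0∞)⁻¹ * (n : ℝ≥0∞)⁻¹) • @Measure.trim Ω F mΩ μ hF := by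
    refine @Measure.ext _ F _ _ fun S hS => ?_
    rw [trim_measurableSet_eq hF hS, Measure.restrict_apply (hF S hS), h c d S hS,
      Measure.smul_apply, trim_measurableSet_eq hF hS, smul_eq_mul]
  rw [integral_trim hF hf, htrim, integral_smul_measure, ← integral_trim hF hf]
  simp [ENNReal.toReal_mul]

lemma UniformPairIndep.integral_eq {Ω : Type*} {m n : ℕ} {F : MeasurableSpace Ω}
    {mΩ : MeasurableSpace Ω} {μ : Measure Ω} (hF : F ≤ mΩ)
    {p : Ω → Fin m} {q : Ω → Fin n} (hp : Measurable p) (hq : Measurable q)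
    (h : UniformPairIndep F μ p q) {Ψ : Fin m → Fin n → Ω → ℝ}
    (hΨ : ∀ c d, StronglyMeasurable[F] (Ψ c d)) (hΨi : ∀ c d, Integrable (Ψ c d) μ) :
    Integrable (fun ω => Ψ (p ω) (q ω) ω) μ ∧
    ∫ ω, Ψ (p ω) (q ω) ω ∂μ
      = (m : ℝ)⁻¹ * (n : ℝ)⁻¹ * ∑ c, ∑ d, ∫ ω, Ψ c d ω ∂μ := by
  have hms : ∀ c d, MeasurableSet {ω | p ω = c ∧ q ω = d} := fun c d =>
    (hp (measurableSet_singleton c)).inter (hq (measurableSet_singleton d))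
  have hdecomp : (fun ω => Ψ (p ω) (q ω) ω)
      = fun ω => ∑ c, ∑ d, {ω | p ω = c ∧ q ω = d}.indicator (Ψ c d) ω := by
    funext ω
    rw [Finset.sum_eq_single (p ω), Finset.sum_eq_single (q ω)]
    · simp
    · intro d _ hd
      simp [hd.symm]
    · simp
    · intro c _ hc
      simp [hc.symm]
    · simp
  have hint : ∀ c d, Integrable ({ω | p ω = c ∧ q ω = d}.indicator (Ψ c d)) μ :=
    fun c d => (hΨi c d).indicator (hms c d)
  rw [hdecomp]
  refine ⟨integrable_finsetSum _ fun c _ => integrable_finsetSum _ fun d _ => hint c d, ?_⟩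
  rw [integral_finsetSum _ fun c _ => integrable_finsetSum _ fun d _ => hint c d, Finset.mul_sum]
  refine Finset.sum_congr rfl fun c _ => ?_
  rw [integral_finsetSum _ fun d _ => hint c d, Finset.mul_sum]
  refine Finset.sum_congr rfl fun d _ => ?_
  rw [integral_indicator (hms c d), h.setIntegral_eq hF c d (hΨ c d)]

/-- Adding one random variable independent of an independent family, at the level of
`σ`-algebras. -/
lemma iIndep_option_elim {Ω ι : Type*} {m₀ : MeasurableSpace Ω}
    {m : ι → MeasurableSpace Ω} {mΩ : MeasurableSpace Ω} {μ : Measure Ω} (hm : iIndep m μ)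
    (h : Indep (⨆ p, m p) m₀ μ) : iIndep (fun o : Option ι => o.elim m₀ m) μ := by
  classical
  have := hm.isProbabilityMeasure
  rw [iIndep_iff]
  intro s f hf
  have hsome : μ (⋂ p ∈ s.eraseNone, f (some p)) = ∏ p ∈ s.eraseNone, μ (f (some p)) :=
    hm.meas_biInter fun p hp => hf (some p) (Finset.mem_eraseNone.1 hp)
  have hmeas : MeasurableSet[⨆ p, m p] (⋂ p ∈ s.eraseNone, f (some p)) :=
    MeasurableSet.biInter s.eraseNone.countable_toSet fun p hp =>
      le_iSup m p _ (hf (some p) (Finset.mem_eraseNone.1 hp))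
  by_cases hs : none ∈ s
  · have hs' : Finset.insertNone s.eraseNone = s := by
      rw [Finset.insertNone_eraseNone, Finset.insert_eq_of_mem hs]
    have hset : ⋂ o ∈ s, f o = (⋂ p ∈ s.eraseNone, f (some p)) ∩ f none := by
      ext ω
      simp only [Set.mem_iInter, Set.mem_inter_iff, Finset.mem_eraseNone]
      refine ⟨fun H => ⟨fun p hp => H _ hp, H _ hs⟩, fun H o ho => ?_⟩
      cases o with
      | none => exact H.2
      | some p => exact H.1 p ho
    rw [hset, (Indep_iff _ _ _).1 h _ _ hmeas (hf none hs), hsome]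
    conv_rhs => rw [← hs', Finset.prod_insertNone]
    rw [mul_comm]
  · have hs' : s.eraseNone.map Function.Embedding.some = s := by
      rw [Finset.map_some_eraseNone, Finset.erase_eq_of_notMem hs]
    have hset : ⋂ o ∈ s, f o = ⋂ p ∈ s.eraseNone, f (some p) := by
      conv_lhs => rw [← hs']
      simp only [Finset.mem_map, Set.iInter_exists, Set.biInter_and',
        Function.Embedding.some_apply, Set.iInter_iInter_eq_right]
    rw [hset, hsome]
    conv_rhs => rw [← hs', Finset.prod_map]
    rfl

/-- The regularity of the inner maps `Gⱼ` (with derivatives `∂Gⱼ`) and of the gradients `∇Fᵢ` used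
in the analysis of Compositional-SVRG. -/
structure CompositionalRegularity {N M m n : ℕ}
    (Gc : Fin m → EuclideanSpace ℝ (Fin N) → EuclideanSpace ℝ (Fin M))
    (DG : Fin m → EuclideanSpace ℝ (Fin N) →
      (EuclideanSpace ℝ (Fin N) →L[ℝ] EuclideanSpace ℝ (Fin M)))
    (gF : Fin n → EuclideanSpace ℝ (Fin M) → EuclideanSpace ℝ (Fin M))
    (BG LF Lf : ℝ) : Prop where
  pos_m : 0 < m
  pos_n : 0 < n
  pos_BG : 0 < BG
  pos_LF : 0 < LF
  pos_Lf : 0 < Lf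
  lipschitz_inner : ∀ j u v, ‖Gc j u - Gc j v‖ ≤ BG * ‖u - v‖
  continuous_deriv : ∀ j, Continuous (DG j)
  norm_deriv_le : ∀ j x, ‖DG j x‖ ≤ BG
  lipschitz_outer : ∀ i u v, ‖gF i u - gF i v‖ ≤ LF * ‖u - v‖
  lipschitz_comp : ∀ x y i j, ‖ContinuousLinearMap.adjoint (DG j x) (gF i (Gbar Gc x))
    - ContinuousLinearMap.adjoint (DG j y) (gF i (Gbar Gc y))‖ ≤ Lf * ‖x - y‖

/-- The variance-reduced estimate `Ĝ` of `G(x)` with reference point `t` and mini-batch `b`. -/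
def innerEstimate {N M m A : ℕ}
    (Gc : Fin m → EuclideanSpace ℝ (Fin N) → EuclideanSpace ℝ (Fin M))
    (b : Fin A → Fin m) (t x : EuclideanSpace ℝ (Fin N)) : EuclideanSpace ℝ (Fin M) :=
  Gbar Gc t - (A : ℝ)⁻¹ • ∑ l : Fin A, (Gc (b l) t - Gc (b l) x)

/-- The centered increment of `Gⱼ` between `x` and `t`. -/
def centeredIncrement {N M m : ℕ}
    (Gc : Fin m → EuclideanSpace ℝ (Fin N) → EuclideanSpace ℝ (Fin M))
    (j : Fin m) (t x : EuclideanSpace ℝ (Fin N)) : EuclideanSpace ℝ (Fin M) :=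
  (Gc j t - Gc j x) - (Gbar Gc t - Gbar Gc x)

/-- The update direction of one Compositional-SVRG-1 iteration. -/
def svrgDirection {N M m n A : ℕ}
    (Gc : Fin m → EuclideanSpace ℝ (Fin N) → EuclideanSpace ℝ (Fin M))
    (DG : Fin m → EuclideanSpace ℝ (Fin N) →
      (EuclideanSpace ℝ (Fin N) →L[ℝ] EuclideanSpace ℝ (Fin M)))
    (gF : Fin n → EuclideanSpace ℝ (Fin M) → EuclideanSpace ℝ (Fin M))
    (b : Fin A → Fin m) (i : Fin n) (j : Fin m) (t x : EuclideanSpace ℝ (Fin N)) :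
    EuclideanSpace ℝ (Fin N) :=
  ContinuousLinearMap.adjoint (DG j x) (gF i (innerEstimate Gc b t x))
    - ContinuousLinearMap.adjoint (DG j t) (gF i (Gbar Gc t)) + gradf Gc DG gF t

/-- The unbiased variance-reduced gradient, in which the inner value `G(x)` is exact. -/
def unbiasedDirection {N M m n : ℕ}
    (Gc : Fin m → EuclideanSpace ℝ (Fin N) → EuclideanSpace ℝ (Fin M))
    (DG : Fin m → EuclideanSpace ℝ (Fin N) →
      (EuclideanSpace ℝ (Fin N) →L[ℝ] EuclideanSpace ℝ (Fin M)))
    (gF : Fin n → EuclideanSpace ℝ (Fin M) → EuclideanSpace ℝ (Fin M))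
    (i : Fin n) (j : Fin m) (t x : EuclideanSpace ℝ (Fin N)) : EuclideanSpace ℝ (Fin N) :=
  ContinuousLinearMap.adjoint (DG j x) (gF i (Gbar Gc x))
    - ContinuousLinearMap.adjoint (DG j t) (gF i (Gbar Gc t)) + gradf Gc DG gF t

section Deterministic

variable {N M m n A : ℕ}
  {Gc : Fin m → EuclideanSpace ℝ (Fin N) → EuclideanSpace ℝ (Fin M)}
  {DG : Fin m → EuclideanSpace ℝ (Fin N) →
    (EuclideanSpace ℝ (Fin N) →L[ℝ] EuclideanSpace ℝ (Fin M))}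
  {gF : Fin n → EuclideanSpace ℝ (Fin M) → EuclideanSpace ℝ (Fin M)}
  {BG LF Lf : ℝ}

lemma norm_average_le {E : Type*} [SeminormedAddCommGroup E] [NormedSpace ℝ E] {k : ℕ} (hk : 0 < k)
    {v : Fin k → E} {C : ℝ} (hv : ∀ c, ‖v c‖ ≤ C) : ‖(k : ℝ)⁻¹ • ∑ c, v c‖ ≤ C := by
  have hk' : (0 : ℝ) < k := by exact_mod_cast hk
  have h : ‖∑ c, v c‖ ≤ k * C := by
    simpa using norm_sum_le_of_le Finset.univ fun c _ => hv c
  rw [norm_smul, norm_inv, Real.norm_of_nonneg hk'.le, inv_mul_le_iff₀ hk']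
  exact h

lemma gradf_eq_average (x : EuclideanSpace ℝ (Fin N)) :
    gradf Gc DG gF x = (m : ℝ)⁻¹ • ∑ j, (n : ℝ)⁻¹ • ∑ i,
      ContinuousLinearMap.adjoint (DG j x) (gF i (Gbar Gc x)) := by
  simp only [gradf, DGbar, gradFbar, map_smulₛₗ, map_sum, smul_apply, sum_apply, conj_trivial,
    Finset.smul_sum]
  rw [Finset.sum_comm]
  exact Finset.sum_congr rfl fun j _ => Finset.sum_congr rfl fun i _ => smul_comm _ _ _

lemma sum_centeredIncrement (hm : 0 < m) (t x : EuclideanSpace ℝ (Fin N)) :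
    ∑ j, centeredIncrement Gc j t x = 0 := by
  have hm' : (m : ℝ) ≠ 0 := by exact_mod_cast hm.ne'
  simp only [centeredIncrement, Finset.sum_sub_distrib, Finset.sum_const, Finset.card_univ,
    Fintype.card_fin, Gbar, ← smul_sub]
  rw [← Nat.cast_smul_eq_nsmul ℝ, smul_smul, mul_inv_cancel₀ hm', one_smul, sub_self]

lemma innerEstimate_sub_Gbar (hA : 0 < A) (b : Fin A → Fin m) (t x : EuclideanSpace ℝ (Fin N)) :
    innerEstimate Gc b t x - Gbar Gc x
      = -((A : ℝ)⁻¹ • ∑ l, centeredIncrement Gc (b l) t x) := by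
  have hA' : (A : ℝ) ≠ 0 := by exact_mod_cast hA.ne'
  simp only [innerEstimate, centeredIncrement]
  rw [Finset.sum_sub_distrib (f := fun l => Gc (b l) t - Gc (b l) x), Finset.sum_const,
    Finset.card_univ, Fintype.card_fin, smul_sub, ← Nat.cast_smul_eq_nsmul ℝ, smul_smul,
    inv_mul_cancel₀ hA', one_smul]
  abel

namespace CompositionalRegularity

variable (hR : CompositionalRegularity Gc DG gF BG LF Lf)
include hR

lemma lipschitz_Gbar (u v : EuclideanSpace ℝ (Fin N)) :
    ‖Gbar Gc u - Gbar Gc v‖ ≤ BG * ‖u - v‖ := by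
  rw [Gbar, Gbar, ← smul_sub, ← Finset.sum_sub_distrib]
  exact norm_average_le hR.pos_m fun j => hR.lipschitz_inner j u v

lemma lipschitz_gradf (u v : EuclideanSpace ℝ (Fin N)) :
    ‖gradf Gc DG gF u - gradf Gc DG gF v‖ ≤ Lf * ‖u - v‖ := by
  rw [gradf_eq_average, gradf_eq_average, ← smul_sub, ← Finset.sum_sub_distrib]
  refine norm_average_le hR.pos_m fun j => ?_
  rw [← smul_sub, ← Finset.sum_sub_distrib]
  exact norm_average_le hR.pos_n fun i => hR.lipschitz_comp u v i j

lemma continuous_inner (j : Fin m) : Continuous (Gc j) :=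
  (LipschitzWith.of_dist_le' fun u v => by
    simpa [dist_eq_norm] using hR.lipschitz_inner j u v).continuous

lemma continuous_outer (i : Fin n) : Continuous (gF i) :=
  (LipschitzWith.of_dist_le' fun u v => by
    simpa [dist_eq_norm] using hR.lipschitz_outer i u v).continuous

lemma continuous_Gbar : Continuous (Gbar Gc) := by
  have := hR.continuous_inner
  unfold Gbar
  fun_prop

lemma continuous_gradf : Continuous (gradf Gc DG gF) :=
  (LipschitzWith.of_dist_le' fun u v => by
    simpa [dist_eq_norm] using hR.lipschitz_gradf u v).continuous

lemma continuous_adjoint_deriv (j : Fin m) :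
    Continuous fun x => ContinuousLinearMap.adjoint (DG j x) :=
  ContinuousLinearMap.adjoint.continuous.comp (hR.continuous_deriv j)

lemma continuous_centeredIncrement (j : Fin m) :
    Continuous fun z : EuclideanSpace ℝ (Fin N) × EuclideanSpace ℝ (Fin N) =>
      centeredIncrement Gc j z.1 z.2 := by
  have := hR.continuous_inner j
  have := hR.continuous_Gbar
  unfold centeredIncrement
  fun_prop

lemma continuous_innerEstimate (b : Fin A → Fin m) :
    Continuous fun z : EuclideanSpace ℝ (Fin N) × EuclideanSpace ℝ (Fin N) =>
      innerEstimate Gc b z.1 z.2 := by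
  have := hR.continuous_inner
  have := hR.continuous_Gbar
  unfold innerEstimate
  fun_prop

lemma continuous_unbiasedDirection (i : Fin n) (j : Fin m) :
    Continuous fun z : EuclideanSpace ℝ (Fin N) × EuclideanSpace ℝ (Fin N) =>
      unbiasedDirection Gc DG gF i j z.1 z.2 := by
  have hadj := hR.continuous_adjoint_deriv j
  exact (((hadj.comp continuous_snd).clm_apply
    ((hR.continuous_outer i).comp (hR.continuous_Gbar.comp continuous_snd))).sub
    ((hadj.comp continuous_fst).clm_apply
      ((hR.continuous_outer i).comp (hR.continuous_Gbar.comp continuous_fst)))).add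
    (hR.continuous_gradf.comp continuous_fst)

lemma continuous_svrgDirection (b : Fin A → Fin m) (i : Fin n) (j : Fin m) :
    Continuous fun z : EuclideanSpace ℝ (Fin N) × EuclideanSpace ℝ (Fin N) =>
      svrgDirection Gc DG gF b i j z.1 z.2 := by
  have hadj := hR.continuous_adjoint_deriv j
  exact (((hadj.comp continuous_snd).clm_apply
    ((hR.continuous_outer i).comp (hR.continuous_innerEstimate b))).sub
    ((hadj.comp continuous_fst).clm_apply
      ((hR.continuous_outer i).comp (hR.continuous_Gbar.comp continuous_fst)))).add
    (hR.continuous_gradf.comp continuous_fst)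

lemma norm_centeredIncrement_le (j : Fin m) (t x : EuclideanSpace ℝ (Fin N)) :
    ‖centeredIncrement Gc j t x‖ ≤ 2 * BG * ‖t - x‖ := by
  refine (norm_sub_le _ _).trans ?_
  linarith [hR.lipschitz_inner j t x, hR.lipschitz_Gbar t x]

lemma norm_innerEstimate_sub_le (hA : 0 < A) (b : Fin A → Fin m)
    (t x : EuclideanSpace ℝ (Fin N)) :
    ‖innerEstimate Gc b t x - Gbar Gc x‖ ≤ 2 * BG * ‖t - x‖ := by
  rw [innerEstimate_sub_Gbar hA, norm_neg]
  exact norm_average_le hA fun l => hR.norm_centeredIncrement_le (b l) t x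

lemma norm_svrgDirection_sub_le (b : Fin A → Fin m) (i : Fin n) (j : Fin m)
    (t x : EuclideanSpace ℝ (Fin N)) :
    ‖svrgDirection Gc DG gF b i j t x - unbiasedDirection Gc DG gF i j t x‖
      ≤ BG * (LF * ‖innerEstimate Gc b t x - Gbar Gc x‖) := by
  have heq : svrgDirection Gc DG gF b i j t x - unbiasedDirection Gc DG gF i j t x
      = ContinuousLinearMap.adjoint (DG j x)
          (gF i (innerEstimate Gc b t x) - gF i (Gbar Gc x)) := by
    rw [svrgDirection, unbiasedDirection, map_sub]
    abel
  rw [heq]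
  refine (ContinuousLinearMap.le_opNorm _ _).trans ?_
  rw [LinearIsometryEquiv.norm_map]
  exact mul_le_mul (hR.norm_deriv_le j x) (hR.lipschitz_outer i _ _) (norm_nonneg _)
    hR.pos_BG.le

lemma norm_unbiasedDirection_sq_le {xs : EuclideanSpace ℝ (Fin N)} (hxs : gradf Gc DG gF xs = 0)
    (i : Fin n) (j : Fin m) (t x : EuclideanSpace ℝ (Fin N)) :
    ‖unbiasedDirection Gc DG gF i j t x‖ ^ 2
      ≤ Lf ^ 2 * (4 * ‖x - xs‖ ^ 2 + 6 * ‖t - xs‖ ^ 2) := by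
  have h1 : ‖unbiasedDirection Gc DG gF i j t x‖ ≤ Lf * (‖x - xs‖ + 2 * ‖t - xs‖) := by
    have ht := hR.lipschitz_gradf t xs
    rw [hxs, sub_zero] at ht
    have htri : ‖x - t‖ ≤ ‖x - xs‖ + ‖t - xs‖ := by
      simpa [norm_sub_rev t xs] using norm_sub_le_norm_sub_add_norm_sub x xs t
    calc _ ≤ Lf * ‖x - t‖ + Lf * ‖t - xs‖ :=
          (norm_add_le _ _).trans (add_le_add (hR.lipschitz_comp x t i j) ht)
      _ ≤ Lf * (‖x - xs‖ + ‖t - xs‖) + Lf * ‖t - xs‖ := by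
          gcongr
          exact hR.pos_Lf.le
      _ = _ := by ring
  calc _ ≤ (Lf * (‖x - xs‖ + 2 * ‖t - xs‖)) ^ 2 := by gcongr
    _ = Lf ^ 2 * (‖x - xs‖ + 2 * ‖t - xs‖) ^ 2 := by ring
    _ ≤ _ := by
      gcongr
      nlinarith [sq_nonneg (‖x - xs‖ - ‖t - xs‖), sq_nonneg ‖x - xs‖]

end CompositionalRegularity

/-- If the first-order minorization of `φ` by a Lipschitz field `g` holds, then `g` vanishes at
every minimizer of `φ`. -/
lemma eq_zero_of_isMin_of_minorization {E : Type*} [NormedAddCommGroup E] [InnerProductSpace ℝ E]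
    {φ : E → ℝ} {g : E → E} {L ν : ℝ} (hL : 0 < L) (hν : 0 < ν)
    (hg : ∀ u v, ‖g u - g v‖ ≤ L * ‖u - v‖)
    (hφ : ∀ x y, φ y ≥ φ x + ⟪g x, y - x⟫ + ν / 2 * ‖y - x‖ ^ 2)
    {xs : E} (hxs : ∀ x, φ xs ≤ φ x) : g xs = 0 := by
  set y := xs - (2 * L)⁻¹ • g xs with hy
  have hsub : xs - y = (2 * L)⁻¹ • g xs := by simp [hy]
  have h1 : ⟪g y, g xs⟫ ≤ 0 := by
    have h := hφ y xs
    rw [hsub, real_inner_smul_right] at h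
    have h2 : (2 * L)⁻¹ * ⟪g y, g xs⟫ ≤ 0 := by
      nlinarith [hxs y, sq_nonneg ‖(2 * L)⁻¹ • g xs‖]
    exact nonpos_of_mul_nonpos_right h2 (by positivity)
  have h2 : ⟪g xs - g y, g xs⟫ ≤ 1 / 2 * ‖g xs‖ ^ 2 := by
    refine (real_inner_le_norm _ _).trans ?_
    have h3 : ‖g xs - g y‖ ≤ 1 / 2 * ‖g xs‖ := by
      refine (hg xs y).trans_eq ?_
      rw [hsub, norm_smul, Real.norm_of_nonneg (by positivity)]
      field_simp
    nlinarith [norm_nonneg (g xs)]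
  rw [inner_sub_left, real_inner_self_eq_norm_sq] at h2
  have h3 : ‖g xs‖ ^ 2 = 0 := le_antisymm (by linarith) (sq_nonneg _)
  simpa using h3

lemma le_inner_of_eq_zero_of_minorization {E : Type*} [NormedAddCommGroup E] [InnerProductSpace ℝ E]
    {φ : E → ℝ} {g : E → E} {ν : ℝ}
    (hφ : ∀ x y, φ y ≥ φ x + ⟪g x, y - x⟫ + ν / 2 * ‖y - x‖ ^ 2)
    {xs : E} (hxs : g xs = 0) (x : E) : ν * ‖x - xs‖ ^ 2 ≤ ⟪g x, x - xs⟫ := by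
  have h1 := hφ x xs
  have h2 := hφ xs x
  rw [← neg_sub x xs, inner_neg_right, norm_neg] at h1
  rw [hxs, inner_zero_left] at h2
  linarith

/-- Expansion of one gradient-type step whose direction `d` is compared with `h`. -/
lemma norm_sub_smul_sq_le {E : Type*} [NormedAddCommGroup E] [InnerProductSpace ℝ E]
    {γ ν : ℝ} (hγ : 0 < γ) (hν : 0 < ν) (v h d : E) :
    ‖v - γ • d‖ ^ 2 ≤ ‖v‖ ^ 2 - 2 * γ * ⟪h, v⟫ + γ * (16 / ν * ‖d - h‖ ^ 2 + ν / 16 * ‖v‖ ^ 2)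
      + 2 * γ ^ 2 * ‖d - h‖ ^ 2 + 2 * γ ^ 2 * ‖h‖ ^ 2 := by
  have h1 : -(2 * ⟪d - h, v⟫) ≤ 16 / ν * ‖d - h‖ ^ 2 + ν / 16 * ‖v‖ ^ 2 := by
    have h2 : -⟪d - h, v⟫ ≤ ‖d - h‖ * ‖v‖ :=
      (neg_le_abs _).trans (abs_real_inner_le_norm _ _)
    have h3 : 16 / ν * ‖d - h‖ ^ 2 + ν / 16 * ‖v‖ ^ 2 - 2 * (‖d - h‖ * ‖v‖)
        = (16 * ‖d - h‖ - ν * ‖v‖) ^ 2 / (16 * ν) := by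
      field_simp
      ring
    have h4 : 0 ≤ (16 * ‖d - h‖ - ν * ‖v‖) ^ 2 / (16 * ν) := by positivity
    linarith
  have h5 : ‖d‖ ^ 2 ≤ 2 * ‖d - h‖ ^ 2 + 2 * ‖h‖ ^ 2 := by
    have h6 := norm_add_le (d - h) h
    rw [sub_add_cancel] at h6
    nlinarith [sq_nonneg (‖d - h‖ - ‖h‖), norm_nonneg d]
  have h7 : ‖v - γ • d‖ ^ 2 = ‖v‖ ^ 2 - 2 * γ * ⟪h, v⟫ - γ * (2 * ⟪d - h, v⟫)
      + γ ^ 2 * ‖d‖ ^ 2 := by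
    rw [norm_sub_sq_real, real_inner_smul_right, norm_smul, Real.norm_of_nonneg hγ.le,
      inner_sub_left, real_inner_comm v d]
    ring
  rw [h7]
  nlinarith [mul_le_mul_of_nonneg_left h1 hγ.le, mul_le_mul_of_nonneg_left h5 (sq_nonneg γ)]

end Deterministic

section OneStep

variable {N M m n A : ℕ}
  {Gc : Fin m → EuclideanSpace ℝ (Fin N) → EuclideanSpace ℝ (Fin M)}
  {DG : Fin m → EuclideanSpace ℝ (Fin N) →
    (EuclideanSpace ℝ (Fin N) →L[ℝ] EuclideanSpace ℝ (Fin M))}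
  {gF : Fin n → EuclideanSpace ℝ (Fin M) → EuclideanSpace ℝ (Fin M)}
  {BG LF Lf : ℝ} {Ω : Type*}

lemma Measurable.eval_index {ι Z Y : Type*} [MeasurableSpace Ω] [MeasurableSpace ι] [Countable ι]
    [MeasurableSingletonClass ι] [MeasurableSpace Z] [MeasurableSpace Y] {Φ : ι → Z → Y}
    (hΦ : ∀ c, Measurable (Φ c)) {p : Ω → ι} (hp : Measurable p) {z : Ω → Z}
    (hz : Measurable z) : Measurable fun ω => Φ (p ω) (z ω) :=
  (measurable_from_prod_countable_right (f := fun q : ι × Z => Φ q.1 q.2) hΦ).comp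
    (hp.prodMk hz)

lemma integrable_norm_sub_sq {E : Type*} [NormedAddCommGroup E] {mΩ : MeasurableSpace Ω}
    {μ : Measure Ω} {X Y : Ω → E} (hX : MemLp X 2 μ) (hY : MemLp Y 2 μ) :
    Integrable (fun ω => ‖X ω - Y ω‖ ^ 2) μ :=
  (hX.sub hY).integrable_norm_pow (by norm_num)

lemma measurable_svrgDirection [MeasurableSpace Ω]
    (hR : CompositionalRegularity Gc DG gF BG LF Lf) {b : Fin A → Ω → Fin m} {i : Ω → Fin n}
    {j : Ω → Fin m} {T X : Ω → EuclideanSpace ℝ (Fin N)} (hb : ∀ l, Measurable (b l))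
    (hi : Measurable i) (hj : Measurable j) (hT : Measurable T) (hX : Measurable X) :
    Measurable fun ω =>
      svrgDirection Gc DG gF (fun l => b l ω) (i ω) (j ω) (T ω) (X ω) :=
  Measurable.eval_index
    (Φ := fun (q : (Fin A → Fin m) × Fin n × Fin m)
      (z : EuclideanSpace ℝ (Fin N) × EuclideanSpace ℝ (Fin N)) =>
        svrgDirection Gc DG gF q.1 q.2.1 q.2.2 z.1 z.2)
    (fun q => (hR.continuous_svrgDirection q.1 q.2.1 q.2.2).measurable)
    (p := fun ω => (fun l => b l ω, i ω, j ω)) (z := fun ω => (T ω, X ω))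
    ((measurable_pi_lambda _ hb).prodMk (hi.prodMk hj)) (hT.prodMk hX)

lemma measurable_innerEstimate [MeasurableSpace Ω]
    (hR : CompositionalRegularity Gc DG gF BG LF Lf) {b : Fin A → Ω → Fin m}
    {T X : Ω → EuclideanSpace ℝ (Fin N)} (hb : ∀ l, Measurable (b l))
    (hT : Measurable T) (hX : Measurable X) :
    Measurable fun ω => innerEstimate Gc (fun l => b l ω) (T ω) (X ω) :=
  Measurable.eval_index
    (Φ := fun (q : Fin A → Fin m)
      (z : EuclideanSpace ℝ (Fin N) × EuclideanSpace ℝ (Fin N)) => innerEstimate Gc q z.1 z.2)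
    (fun q => (hR.continuous_innerEstimate q).measurable)
    (p := fun ω l => b l ω) (z := fun ω => (T ω, X ω)) (measurable_pi_lambda _ hb) (hT.prodMk hX)

/-- The mini-batch estimate of `G` has mean-square error of order `1 / A`. -/
lemma integral_norm_innerEstimate_sub_sq_le {F mΩ : MeasurableSpace Ω} {μ : Measure Ω}
    (hR : CompositionalRegularity Gc DG gF BG LF Lf) (hA : 0 < A) (hF : F ≤ mΩ)
    {b : Fin A → Ω → Fin m} {T X : Ω → EuclideanSpace ℝ (Fin N)}
    (hb : ∀ l, Measurable (b l)) (hT : Measurable[F] T) (hX : Measurable[F] X)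
    (hT2 : MemLp T 2 μ) (hX2 : MemLp X 2 μ)
    (hpair : ∀ l l', l ≠ l' → UniformPairIndep F μ (b l) (b l')) :
    ∫ ω, ‖innerEstimate Gc (fun l => b l ω) (T ω) (X ω) - Gbar Gc (X ω)‖ ^ 2 ∂μ
      ≤ 4 * BG ^ 2 / A * ∫ ω, ‖T ω - X ω‖ ^ 2 ∂μ := by
  have hA' : (0 : ℝ) < A := by exact_mod_cast hA
  have hTX := integrable_norm_sub_sq hT2 hX2
  let W : Fin m → Ω → EuclideanSpace ℝ (Fin M) := fun c ω => centeredIncrement Gc c (T ω) (X ω)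
  have hWm : ∀ c, Measurable[F] (W c) := fun c =>
    (hR.continuous_centeredIncrement c).measurable.comp (hT.prodMk hX)
  have hWle : ∀ c d ω, |⟪W c ω, W d ω⟫| ≤ 4 * BG ^ 2 * ‖T ω - X ω‖ ^ 2 := by
    intro c d ω
    have hc := hR.norm_centeredIncrement_le c (T ω) (X ω)
    have hd := hR.norm_centeredIncrement_le d (T ω) (X ω)
    calc _ ≤ ‖W c ω‖ * ‖W d ω‖ := abs_real_inner_le_norm _ _
      _ ≤ (2 * BG * ‖T ω - X ω‖) * (2 * BG * ‖T ω - X ω‖) :=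
        mul_le_mul hc hd (norm_nonneg _) ((norm_nonneg _).trans hc)
      _ = _ := by ring
  have hΨm : ∀ c d, StronglyMeasurable[F] fun ω => ⟪W c ω, W d ω⟫ := fun c d =>
    ((hWm c).inner (hWm d)).stronglyMeasurable
  have hΨi : ∀ c d, Integrable (fun ω => ⟪W c ω, W d ω⟫) μ := fun c d =>
    (hTX.const_mul (4 * BG ^ 2)).mono' ((hΨm c d).mono hF).aestronglyMeasurable
      (Filter.Eventually.of_forall fun ω => hWle c d ω)
  have hbi : ∀ l l', Integrable (fun ω => ⟪W (b l ω) ω, W (b l' ω) ω⟫) μ := by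
    intro l l'
    refine (hTX.const_mul (4 * BG ^ 2)).mono' ?_ (Filter.Eventually.of_forall fun ω => hWle _ _ ω)
    have hWb : ∀ l, Measurable fun ω => W (b l ω) ω := fun l =>
      Measurable.eval_index (fun c => (hWm c).mono hF le_rfl) (hb l) measurable_id
    exact ((hWb l).inner (hWb l')).aestronglyMeasurable
  have hoff : ∀ l l', l ≠ l' → ∫ ω, ⟪W (b l ω) ω, W (b l' ω) ω⟫ ∂μ = 0 := by
    intro l l' hll
    rw [((hpair l l' hll).integral_eq hF (hb l) (hb l')
      (Ψ := fun c d ω => ⟪W c ω, W d ω⟫) hΨm hΨi).2]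
    have hzero : ∀ c, ∑ d, ∫ ω, ⟪W c ω, W d ω⟫ ∂μ = 0 := by
      intro c
      rw [← integral_finsetSum _ fun d _ => hΨi c d]
      simp only [← inner_sum, W, sum_centeredIncrement hR.pos_m, inner_zero_right, integral_zero]
    simp [hzero]
  have hexp : ∀ ω, ‖innerEstimate Gc (fun l => b l ω) (T ω) (X ω) - Gbar Gc (X ω)‖ ^ 2
      = ((A : ℝ)⁻¹) ^ 2 * ∑ l, ∑ l', ⟪W (b l ω) ω, W (b l' ω) ω⟫ := by
    intro ω
    rw [innerEstimate_sub_Gbar hA, norm_neg, norm_smul, mul_pow, Real.norm_of_nonneg (by positivity),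
      ← real_inner_self_eq_norm_sq, sum_inner]
    simp only [inner_sum, W]
  simp_rw [hexp]
  rw [integral_const_mul, integral_finsetSum _ fun l _ => integrable_finsetSum _ fun l' _ => hbi l l']
  have hrow : ∀ l, ∫ ω, ∑ l', ⟪W (b l ω) ω, W (b l' ω) ω⟫ ∂μ
      ≤ 4 * BG ^ 2 * ∫ ω, ‖T ω - X ω‖ ^ 2 ∂μ := by
    intro l
    rw [integral_finsetSum _ fun l' _ => hbi l l',
      Finset.sum_eq_single l (fun l' _ hl' => hoff l l' hl'.symm) (by simp), ← integral_const_mul]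
    exact integral_mono (hbi l l) (hTX.const_mul _) fun ω => (le_abs_self _).trans (hWle _ _ ω)
  calc _ ≤ ((A : ℝ)⁻¹) ^ 2 * ∑ _l : Fin A, 4 * BG ^ 2 * ∫ ω, ‖T ω - X ω‖ ^ 2 ∂μ := by
        gcongr with l
        exact hrow l
    _ = _ := by
        rw [Finset.sum_const, Finset.card_univ, Fintype.card_fin, nsmul_eq_mul]
        field_simp

lemma integral_inner_unbiasedDirection {F mΩ : MeasurableSpace Ω} {μ : Measure Ω}
    [IsProbabilityMeasure μ]
    (hR : CompositionalRegularity Gc DG gF BG LF Lf) (hF : F ≤ mΩ)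
    {i : Ω → Fin n} {j : Ω → Fin m} {T X : Ω → EuclideanSpace ℝ (Fin N)}
    (hi : Measurable i) (hj : Measurable j) (hT : Measurable[F] T) (hX : Measurable[F] X)
    (hT2 : MemLp T 2 μ) (hX2 : MemLp X 2 μ) (hpair : UniformPairIndep F μ j i)
    {xs : EuclideanSpace ℝ (Fin N)} (hxs : gradf Gc DG gF xs = 0) :
    Integrable (fun ω => ⟪unbiasedDirection Gc DG gF (i ω) (j ω) (T ω) (X ω), X ω - xs⟫) μ ∧
    ∫ ω, ⟪unbiasedDirection Gc DG gF (i ω) (j ω) (T ω) (X ω), X ω - xs⟫ ∂μ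
      = ∫ ω, ⟪gradf Gc DG gF (X ω), X ω - xs⟫ ∂μ := by
  have hm : (m : ℝ) ≠ 0 := by exact_mod_cast hR.pos_m.ne'
  have hn : (n : ℝ) ≠ 0 := by exact_mod_cast hR.pos_n.ne'
  have hTs := integrable_norm_sub_sq hT2 (memLp_const xs)
  have hXs := integrable_norm_sub_sq hX2 (memLp_const xs)
  let Ψ : Fin m → Fin n → Ω → ℝ := fun c d ω =>
    ⟪unbiasedDirection Gc DG gF d c (T ω) (X ω), X ω - xs⟫
  have hΨm : ∀ c d, StronglyMeasurable[F] (Ψ c d) := fun c d => by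
    have h1 : Measurable[F] fun ω => unbiasedDirection Gc DG gF d c (T ω) (X ω) :=
      Measurable.comp (g := fun z : EuclideanSpace ℝ (Fin N) × EuclideanSpace ℝ (Fin N) =>
        unbiasedDirection Gc DG gF d c z.1 z.2) (f := fun ω => (T ω, X ω))
        (hR.continuous_unbiasedDirection d c).measurable (hT.prodMk hX)
    exact (h1.inner (hX.sub_const xs)).stronglyMeasurable
  have hΨi : ∀ c d, Integrable (Ψ c d) μ := fun c d => by
    refine (((hXs.const_mul 4).add (hTs.const_mul 6)).const_mul (Lf ^ 2) |>.add hXs).mono'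
      ((hΨm c d).mono hF).aestronglyMeasurable (Filter.Eventually.of_forall fun ω => ?_)
    have h1 := hR.norm_unbiasedDirection_sq_le hxs d c (T ω) (X ω)
    refine (abs_real_inner_le_norm _ _).trans ?_
    simp only [Pi.add_apply]
    nlinarith [sq_nonneg (‖unbiasedDirection Gc DG gF d c (T ω) (X ω)‖ - ‖X ω - xs‖),
      sq_nonneg ‖unbiasedDirection Gc DG gF d c (T ω) (X ω)‖, sq_nonneg ‖X ω - xs‖]
  obtain ⟨hint, heq⟩ := hpair.integral_eq hF hj hi hΨm hΨi
  refine ⟨hint, heq.trans ?_⟩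
  simp_rw [← integral_finsetSum Finset.univ fun d _ => hΨi _ d]
  rw [← integral_finsetSum _ fun c _ => integrable_finsetSum _ fun d _ => hΨi c d,
    ← integral_const_mul]
  refine integral_congr_ae (Filter.Eventually.of_forall fun ω => ?_)
  have hsum : ∀ y, ∑ c, ∑ d, ContinuousLinearMap.adjoint (DG c y) (gF d (Gbar Gc y))
      = ((m : ℝ) * n) • gradf Gc DG gF y := by
    intro y
    rw [gradf_eq_average, ← Finset.smul_sum, smul_smul, smul_smul]
    field_simp
    simp
  simp only [Ψ, ← sum_inner]
  simp only [unbiasedDirection, Finset.sum_add_distrib, Finset.sum_sub_distrib, hsum,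
    Finset.sum_const, Finset.card_univ, Fintype.card_fin, ← Nat.cast_smul_eq_nsmul ℝ, smul_smul,
    sub_add_cancel, real_inner_smul_left]
  field_simp

/-- Integrated form of one inner iteration of Compositional-SVRG-1. -/
lemma svrg_one_step {F mΩ : MeasurableSpace Ω} {μ : Measure Ω} [IsProbabilityMeasure μ]
    (hR : CompositionalRegularity Gc DG gF BG LF Lf) (hA : 0 < A) (hF : F ≤ mΩ)
    {b : Fin A → Ω → Fin m} {i : Ω → Fin n} {j : Ω → Fin m}
    {T X : Ω → EuclideanSpace ℝ (Fin N)} (hb : ∀ l, Measurable (b l))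
    (hi : Measurable i) (hj : Measurable j) (hT : Measurable[F] T) (hX : Measurable[F] X)
    (hT2 : MemLp T 2 μ) (hX2 : MemLp X 2 μ)
    (hbb : ∀ l l', l ≠ l' → UniformPairIndep F μ (b l) (b l'))
    (hji : UniformPairIndep F μ j i)
    {xs : EuclideanSpace ℝ (Fin N)} (hxs : gradf Gc DG gF xs = 0) {ν γ : ℝ} (hν : 0 < ν)
    (hmono : ∀ x, ν * ‖x - xs‖ ^ 2 ≤ ⟪gradf Gc DG gF x, x - xs⟫) (hνL : ν ≤ Lf)
    (hγ : γ = ν / (32 * Lf ^ 2)) (hAc : 512 * BG ^ 4 * LF ^ 2 / ν ^ 2 ≤ (A : ℝ))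
    {X' : Ω → EuclideanSpace ℝ (Fin N)}
    (hX' : ∀ ω, X' ω = X ω
      - γ • svrgDirection Gc DG gF (fun l => b l ω) (i ω) (j ω) (T ω) (X ω)) :
    MemLp X' 2 μ ∧
    ∫ ω, ‖X' ω - xs‖ ^ 2 ∂μ ≤ ∫ ω, ‖X ω - xs‖ ^ 2 ∂μ
      - 7 / 5 * (γ * ν) * ∫ ω, ‖X ω - xs‖ ^ 2 ∂μ
      + 13 / 20 * (γ * ν) * ∫ ω, ‖T ω - xs‖ ^ 2 ∂μ := by
  have hL := hR.pos_Lf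
  have hγpos : 0 < γ := by rw [hγ]; positivity
  have hA' : (0 : ℝ) < A := by exact_mod_cast hA
  have hT' := hT.mono hF le_rfl
  have hXm := hX.mono hF le_rfl
  have hTs := integrable_norm_sub_sq hT2 (memLp_const xs)
  have hXs := integrable_norm_sub_sq hX2 (memLp_const xs)
  have hTX := integrable_norm_sub_sq hT2 hX2
  set e : Ω → ℝ := fun ω =>
    ‖innerEstimate Gc (fun l => b l ω) (T ω) (X ω) - Gbar Gc (X ω)‖ ^ 2 with he
  have hei : Integrable e μ := by
    refine (hTX.const_mul (4 * BG ^ 2)).mono'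
      (((measurable_innerEstimate hR hb hT' hXm).sub
        (hR.continuous_Gbar.measurable.comp hXm)).norm.pow_const 2).aestronglyMeasurable
      (Filter.Eventually.of_forall fun ω => ?_)
    have h1 := hR.norm_innerEstimate_sub_le hA (fun l => b l ω) (T ω) (X ω)
    rw [Real.norm_of_nonneg (by positivity)]
    simp only [he]
    calc _ ≤ (2 * BG * ‖T ω - X ω‖) ^ 2 := by gcongr
      _ = _ := by ring
  obtain ⟨hui, hueq⟩ := integral_inner_unbiasedDirection hR hF hi hj hT hX hT2 hX2 hji hxs
  set u : Ω → ℝ := fun ω =>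
    ⟪unbiasedDirection Gc DG gF (i ω) (j ω) (T ω) (X ω), X ω - xs⟫ with hu
  have hpt : ∀ ω, ‖X' ω - xs‖ ^ 2 ≤ (1 + γ * ν / 16 + 8 * γ ^ 2 * Lf ^ 2) * ‖X ω - xs‖ ^ 2
      - 2 * γ * u ω + (16 * γ / ν + 2 * γ ^ 2) * (BG * LF) ^ 2 * e ω
      + 12 * γ ^ 2 * Lf ^ 2 * ‖T ω - xs‖ ^ 2 := by
    intro ω
    have h1 := norm_sub_smul_sq_le hγpos hν (X ω - xs)
      (unbiasedDirection Gc DG gF (i ω) (j ω) (T ω) (X ω))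
      (svrgDirection Gc DG gF (fun l => b l ω) (i ω) (j ω) (T ω) (X ω))
    have h2 := hR.norm_svrgDirection_sub_le (fun l => b l ω) (i ω) (j ω) (T ω) (X ω)
    have h3 := hR.norm_unbiasedDirection_sq_le hxs (i ω) (j ω) (T ω) (X ω)
    have h4 : ‖svrgDirection Gc DG gF (fun l => b l ω) (i ω) (j ω) (T ω) (X ω)
        - unbiasedDirection Gc DG gF (i ω) (j ω) (T ω) (X ω)‖ ^ 2 ≤ (BG * LF) ^ 2 * e ω := by
      calc _ ≤ (BG * (LF * ‖innerEstimate Gc (fun l => b l ω) (T ω) (X ω)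
            - Gbar Gc (X ω)‖)) ^ 2 := by gcongr
        _ = _ := by rw [he]; ring
    have h5 : X' ω - xs = X ω - xs
        - γ • svrgDirection Gc DG gF (fun l => b l ω) (i ω) (j ω) (T ω) (X ω) := by
      rw [hX']
      abel
    rw [h5]
    refine h1.trans ?_
    have h6 : 0 ≤ 16 * γ / ν + 2 * γ ^ 2 := by positivity
    have h7 := mul_le_mul_of_nonneg_left h4 h6
    have h8 := mul_le_mul_of_nonneg_left h3 (show 0 ≤ 2 * γ ^ 2 by positivity)
    have h9 : γ * (16 / ν * ‖svrgDirection Gc DG gF (fun l => b l ω) (i ω) (j ω) (T ω) (X ω)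
        - unbiasedDirection Gc DG gF (i ω) (j ω) (T ω) (X ω)‖ ^ 2)
        = 16 * γ / ν * ‖svrgDirection Gc DG gF (fun l => b l ω) (i ω) (j ω) (T ω) (X ω)
        - unbiasedDirection Gc DG gF (i ω) (j ω) (T ω) (X ω)‖ ^ 2 := by ring
    rw [mul_add γ, h9]
    linarith
  have hbi := ((((hXs.const_mul (1 + γ * ν / 16 + 8 * γ ^ 2 * Lf ^ 2)).sub
    (hui.const_mul (2 * γ))).add
    (hei.const_mul ((16 * γ / ν + 2 * γ ^ 2) * (BG * LF) ^ 2))).add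
    (hTs.const_mul (12 * γ ^ 2 * Lf ^ 2)))
  have hX'm : Measurable X' := by
    rw [show X' = _ from funext hX']
    exact hXm.sub ((measurable_svrgDirection hR hb hi hj hT' hXm).const_smul γ)
  have hX'i : Integrable (fun ω => ‖X' ω - xs‖ ^ 2) μ :=
    hbi.mono' ((hX'm.sub_const xs).norm.pow_const 2).aestronglyMeasurable
      (Filter.Eventually.of_forall fun ω => by
        rw [Real.norm_of_nonneg (by positivity)]
        exact hpt ω)
  refine ⟨?_, ?_⟩
  · have h1 : MemLp (fun ω => X' ω - xs) 2 μ :=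
      (memLp_two_iff_integrable_sq_norm (hX'm.sub_const xs).aestronglyMeasurable).2 hX'i
    simpa [Pi.add_def] using h1.add (memLp_const xs)
  have hE := integral_mono hX'i hbi hpt
  simp only [Pi.add_apply, Pi.sub_apply] at hE
  rw [integral_add _ (hTs.const_mul _), integral_add _ (hei.const_mul _),
    integral_sub (hXs.const_mul _) (hui.const_mul _), integral_const_mul, integral_const_mul,
    integral_const_mul, integral_const_mul, hueq] at hE
  rotate_left
  · exact (hXs.const_mul _).sub (hui.const_mul _)
  · exact ((hXs.const_mul _).sub (hui.const_mul _)).add (hei.const_mul _)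
  have hEe : ∫ ω, e ω ∂μ ≤ 4 * BG ^ 2 / A * ∫ ω, ‖T ω - X ω‖ ^ 2 ∂μ :=
    integral_norm_innerEstimate_sub_sq_le hR hA hF hb hT hX hT2 hX2 hbb
  have hETX : ∫ ω, ‖T ω - X ω‖ ^ 2 ∂μ
      ≤ 2 * ∫ ω, ‖T ω - xs‖ ^ 2 ∂μ + 2 * ∫ ω, ‖X ω - xs‖ ^ 2 ∂μ := by
    rw [← integral_const_mul, ← integral_const_mul,
      ← integral_add (hTs.const_mul _) (hXs.const_mul _)]
    refine integral_mono hTX ((hTs.const_mul _).add (hXs.const_mul _)) fun ω => ?_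
    have h1 : ‖T ω - X ω‖ ≤ ‖T ω - xs‖ + ‖X ω - xs‖ := by
      simpa [norm_sub_rev xs (X ω)] using norm_sub_le_norm_sub_add_norm_sub (T ω) xs (X ω)
    simp only
    nlinarith [sq_nonneg (‖T ω - xs‖ - ‖X ω - xs‖), norm_nonneg (T ω - X ω)]
  have hEu : ν * ∫ ω, ‖X ω - xs‖ ^ 2 ∂μ ≤ ∫ ω, ⟪gradf Gc DG gF (X ω), X ω - xs⟫ ∂μ := by
    rw [← integral_const_mul]
    refine integral_mono (hXs.const_mul ν) ?_ fun ω => hmono (X ω)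
    refine (hXs.const_mul Lf).mono' (((hR.continuous_gradf.measurable.comp hXm).inner
      (hXm.sub_const xs)).aestronglyMeasurable) (Filter.Eventually.of_forall fun ω => ?_)
    have h1 := hR.lipschitz_gradf (X ω) xs
    rw [hxs, sub_zero] at h1
    calc _ ≤ ‖gradf Gc DG gF (X ω)‖ * ‖X ω - xs‖ := abs_real_inner_le_norm _ _
      _ ≤ Lf * ‖X ω - xs‖ * ‖X ω - xs‖ := by gcongr
      _ = _ := by ring
  have hDX : 0 ≤ ∫ ω, ‖X ω - xs‖ ^ 2 ∂μ := integral_nonneg fun ω => by positivity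
  have hDT : 0 ≤ ∫ ω, ‖T ω - xs‖ ^ 2 ∂μ := integral_nonneg fun ω => by positivity
  have hbias : (BG * LF) ^ 2 * ∫ ω, e ω ∂μ
      ≤ ν ^ 2 / 64 * (∫ ω, ‖T ω - xs‖ ^ 2 ∂μ + ∫ ω, ‖X ω - xs‖ ^ 2 ∂μ) := by
    have h1 : (BG * LF) ^ 2 * (4 * BG ^ 2 / A) ≤ ν ^ 2 / 128 := by
      rw [div_le_iff₀ (by positivity)] at hAc
      rw [mul_div_assoc', div_le_iff₀ hA']
      linarith
    calc _ ≤ (BG * LF) ^ 2 * (4 * BG ^ 2 / A * ∫ ω, ‖T ω - X ω‖ ^ 2 ∂μ) := by gcongr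
      _ = (BG * LF) ^ 2 * (4 * BG ^ 2 / A) * ∫ ω, ‖T ω - X ω‖ ^ 2 ∂μ := by ring
      _ ≤ ν ^ 2 / 128 * (2 * ∫ ω, ‖T ω - xs‖ ^ 2 ∂μ + 2 * ∫ ω, ‖X ω - xs‖ ^ 2 ∂μ) := by
        gcongr
      _ = _ := by ring
  have hγL : γ * Lf ^ 2 = ν / 32 := by
    rw [hγ]
    field_simp
  have hγν : γ * ν ≤ 1 / 32 := by
    rw [hγ, div_mul_eq_mul_div, div_le_iff₀ (by positivity)]
    nlinarith
  generalize ∫ ω, ‖X ω - xs‖ ^ 2 ∂μ = P at *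
  generalize ∫ ω, ‖T ω - xs‖ ^ 2 ∂μ = Q at *
  have h1 : 8 * γ ^ 2 * Lf ^ 2 = γ * ν / 4 := by linear_combination 8 * γ * hγL
  have h2 : 12 * γ ^ 2 * Lf ^ 2 = 3 / 8 * (γ * ν) := by linear_combination 12 * γ * hγL
  have h3 : (16 * γ / ν + 2 * γ ^ 2) * (ν ^ 2 / 64 * (Q + P))
      = γ * ν / 4 * (Q + P) + γ * ν * (γ * ν) / 32 * (Q + P) := by
    field_simp
    ring
  have h4 := mul_le_mul_of_nonneg_left hbias (show 0 ≤ 16 * γ / ν + 2 * γ ^ 2 by positivity)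
  have h5 := mul_le_mul_of_nonneg_left hEu hγpos.le
  have h6 : γ * ν * (γ * ν) / 32 * (Q + P) ≤ γ * ν / 1024 * (Q + P) := by
    have : γ * ν * (γ * ν) ≤ γ * ν * (1 / 32) := by gcongr
    calc _ = γ * ν * (γ * ν) * ((Q + P) / 32) := by ring
      _ ≤ γ * ν * (1 / 32) * ((Q + P) / 32) :=
        mul_le_mul_of_nonneg_right this (by positivity)
      _ = _ := by ring
  rw [h3] at h4
  rw [h1, h2] at hE
  have h7 : 0 ≤ γ * ν * P := by positivity
  have h8 : 0 ≤ γ * ν * Q := by positivity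
  nlinarith

end OneStep

section Independence

variable {Ω ι E : Type*}

/-- The `σ`-algebra generated by `X` and by the indices `U p`, `p ∈ S`. -/
abbrev history [MeasurableSpace E] (U : ι → Ω → ℕ) (X : Ω → E) (S : Set ι) : MeasurableSpace Ω :=
  MeasurableSpace.comap X inferInstance ⊔ ⨆ p ∈ S, MeasurableSpace.comap (U p) ⊤

lemma history_mono [MeasurableSpace E] (U : ι → Ω → ℕ) (X : Ω → E) {S S' : Set ι} (h : S ⊆ S') :
    history U X S ≤ history U X S' :=
  sup_le_sup_left (biSup_mono h) _

lemma history_le [MeasurableSpace E] [mΩ : MeasurableSpace Ω] {U : ι → Ω → ℕ} {X : Ω → E}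
    (hU : ∀ p, Measurable (U p)) (hX : Measurable X) (S : Set ι) : history U X S ≤ mΩ :=
  sup_le hX.comap_le (iSup₂_le fun p _ => (hU p).comap_le)

lemma measurable_history [MeasurableSpace E] (U : ι → Ω → ℕ) (X : Ω → E) (S : Set ι) :
    Measurable[history U X S] X :=
  Measurable.of_comap_le le_sup_left

lemma measurable_history_index [MeasurableSpace E] {U : ι → Ω → ℕ} (X : Ω → E) {S : Set ι} {s : ι}
    (hs : s ∈ S) {k : ℕ} {p : Ω → Fin k} (hp : ∀ ω, U s ω = p ω) :
    Measurable[history U X S] p := by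
  refine @measurable_to_countable' _ _ _ _ (history U X S) _ fun c => ?_
  have hle : MeasurableSpace.comap (U s) ⊤ ≤ history U X S :=
    (le_iSup₂ (f := fun p (_ : p ∈ S) => MeasurableSpace.comap (U p) ⊤) s hs).trans le_sup_right
  refine hle _ ⟨{(c : ℕ)}, trivial, ?_⟩
  ext ω
  simp [hp, Fin.ext_iff]

lemma uniformPairIndep_history [MeasurableSpace E] [mΩ : MeasurableSpace Ω] {μ : Measure Ω}
    {U : ι → Ω → ℕ} {X : Ω → E} (hU : ∀ p, Measurable (U p)) (hX : Measurable X)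
    (hindep : iIndepFun U μ) (hUX : IndepFun (fun ω p => U p ω) X μ)
    {S : Set ι} {s t : ι} (hs : s ∉ S) (ht : t ∉ S) (hst : s ≠ t) {k l : ℕ} {p : Ω → Fin k}
    {q : Ω → Fin l} (hp : ∀ ω, U s ω = p ω) (hq : ∀ ω, U t ω = q ω)
    (hpu : ∀ c, μ {ω | p ω = c} = (k : ℝ≥0∞)⁻¹) (hqu : ∀ c, μ {ω | q ω = c} = (l : ℝ≥0∞)⁻¹) :
    UniformPairIndep (history U X S) μ p q := by
  intro c d H hH
  let 𝓜 : Option ι → MeasurableSpace Ω := fun o =>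
    o.elim (MeasurableSpace.comap X inferInstance) fun p => MeasurableSpace.comap (U p) ⊤
  have h𝓜 : iIndep 𝓜 μ := by
    refine iIndep_option_elim ((iIndepFun_iff_iIndep _ _ _).1 hindep) ?_
    have h := (IndepFun_iff_Indep _ _ _).1 hUX
    simp only [MeasurableSpace.pi, MeasurableSpace.comap_iSup, MeasurableSpace.comap_comp,
      Function.comp_def] at h
    exact h
  have h𝓜le : ∀ o, 𝓜 o ≤ mΩ := by
    rintro (_ | p)
    · exact hX.comap_le
    · exact (hU p).comap_le
  have hdisj : Disjoint (insert none (some '' S)) ({some s, some t} : Set (Option ι)) := by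
    simp only [Set.disjoint_left, Set.mem_insert_iff, Set.mem_image, Set.mem_singleton_iff]
    rintro _ (rfl | ⟨a, ha, rfl⟩) (h | h)
    · cases h
    · cases h
    · exact hs (Option.some.inj h ▸ ha)
    · exact ht (Option.some.inj h ▸ ha)
  have hI := indep_iSup_of_disjoint h𝓜le h𝓜 hdisj
  have hH' : MeasurableSet[⨆ o ∈ insert none (some '' S), 𝓜 o] H := by
    rw [iSup_insert, iSup_image]
    exact hH
  have hset : {ω | p ω = c ∧ q ω = d} = U s ⁻¹' {(c : ℕ)} ∩ U t ⁻¹' {(d : ℕ)} := by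
    ext ω
    simp [hp, hq, Fin.ext_iff]
  have hmeas : MeasurableSet[⨆ o ∈ ({some s, some t} : Set (Option ι)), 𝓜 o]
      {ω | p ω = c ∧ q ω = d} := by
    rw [hset, iSup_pair]
    refine MeasurableSet.inter ?_ ?_
    · exact (le_sup_left : 𝓜 (some s) ≤ _) _ ⟨_, trivial, rfl⟩
    · exact (le_sup_right : 𝓜 (some t) ≤ _) _ ⟨_, trivial, rfl⟩
  rw [(Indep_iff _ _ _).1 hI _ _ hH' hmeas, mul_comm, hset,
    (hindep.indepFun hst).measure_inter_preimage_eq_mul _ _ (measurableSet_singleton _)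
      (measurableSet_singleton _), ← hpu c, ← hqu d]
  congr 3 <;> ext ω <;> simp [hp, hq, Fin.ext_iff]

end Independence

/-- Summing the recursion `D (k + 1) ≤ D k - α D k + β D₀`. -/
lemma sum_le_of_contraction_recursion {D : ℕ → ℝ} {α β : ℝ} {K : ℕ}
    (h : ∀ k < K, D (k + 1) ≤ D k - α * D k + β * D 0) :
    α * ∑ k ∈ Finset.range K, D k ≤ D 0 - D K + K * β * D 0 := by
  induction K with
  | zero => simp
  | succ K ih =>
    rw [Finset.sum_range_succ]
    push_cast
    linarith [ih fun k hk => h k (by omega), h K (by omega)]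

/-- The inner iterates of a Compositional-SVRG-1 epoch, as a function of the drawn indices and of
the reference point. -/
def svrgIterate {N M m n K A : ℕ}
    (Gc : Fin m → EuclideanSpace ℝ (Fin N) → EuclideanSpace ℝ (Fin M))
    (DG : Fin m → EuclideanSpace ℝ (Fin N) →
      (EuclideanSpace ℝ (Fin N) →L[ℝ] EuclideanSpace ℝ (Fin M)))
    (gF : Fin n → EuclideanSpace ℝ (Fin M) → EuclideanSpace ℝ (Fin M)) (γ : ℝ)
    (b : Fin K → Fin A → Fin m) (i : Fin K → Fin n) (j : Fin K → Fin m)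
    (t : EuclideanSpace ℝ (Fin N)) : ℕ → EuclideanSpace ℝ (Fin N)
  | 0 => t
  | k + 1 =>
    if hk : k < K then
      svrgIterate Gc DG gF γ b i j t k - γ • svrgDirection Gc DG gF (b ⟨k, hk⟩) (i ⟨k, hk⟩)
        (j ⟨k, hk⟩) t (svrgIterate Gc DG gF γ b i j t k)
    else svrgIterate Gc DG gF γ b i j t k

/-- The indices of an epoch as one family: the entry `(k, l)` is `a k l` for `l < A`, `i k` for
`l = A`, and `j k` for `l = A + 1`. -/
def epochIndex {Ω : Type*} {m n K A : ℕ} (a : Fin K → Fin A → Ω → Fin m) (i : Fin K → Ω → Fin n)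
    (j : Fin K → Ω → Fin m) (p : Fin K × Fin (A + 2)) (ω : Ω) : ℕ :=
  if h : ((p.2 : ℕ)) < A then ((a p.1 ⟨(p.2 : ℕ), h⟩ ω : ℕ))
  else if (p.2 : ℕ) = A then ((i p.1 ω : ℕ)) else ((j p.1 ω : ℕ))

section Epoch

variable {Ω : Type*} {m n K A : ℕ} {a : Fin K → Fin A → Ω → Fin m} {i : Fin K → Ω → Fin n}
  {j : Fin K → Ω → Fin m}

lemma epochIndex_batch (k : Fin K) (l : Fin A) (ω : Ω) :
    epochIndex a i j (k, ⟨l, by omega⟩) ω = a k l ω := by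
  simp [epochIndex]

lemma epochIndex_outer (k : Fin K) (ω : Ω) :
    epochIndex a i j (k, ⟨A, by omega⟩) ω = i k ω := by
  simp [epochIndex]

lemma epochIndex_jacobian (k : Fin K) (ω : Ω) :
    epochIndex a i j (k, ⟨A + 1, by omega⟩) ω = j k ω := by
  simp [epochIndex]

lemma measurable_epochIndex [MeasurableSpace Ω] (ha : ∀ k l, Measurable (a k l))
    (hi : ∀ k, Measurable (i k)) (hj : ∀ k, Measurable (j k)) (p : Fin K × Fin (A + 2)) :
    Measurable (epochIndex a i j p) := by
  unfold epochIndex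
  split_ifs
  · exact (measurable_from_top (f := Fin.val)).comp (ha _ _)
  · exact (measurable_from_top (f := Fin.val)).comp (hi _)
  · exact (measurable_from_top (f := Fin.val)).comp (hj _)

/-- The epoch contraction when the reference point is a genuinely measurable random vector. -/
lemma svrg_epoch_contraction {N M : ℕ}
    {Gc : Fin m → EuclideanSpace ℝ (Fin N) → EuclideanSpace ℝ (Fin M)}
    {DG : Fin m → EuclideanSpace ℝ (Fin N) →
      (EuclideanSpace ℝ (Fin N) →L[ℝ] EuclideanSpace ℝ (Fin M))}
    {gF : Fin n → EuclideanSpace ℝ (Fin M) → EuclideanSpace ℝ (Fin M)} {BG LF Lf : ℝ}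
    [mΩ : MeasurableSpace Ω] {μ : Measure Ω} [IsProbabilityMeasure μ]
    (hR : CompositionalRegularity Gc DG gF BG LF Lf) (hA : 0 < A) (hK : 0 < K)
    (ha_meas : ∀ k l, Measurable (a k l)) (hi_meas : ∀ k, Measurable (i k))
    (hj_meas : ∀ k, Measurable (j k))
    (ha_unif : ∀ k l c, μ {ω | a k l ω = c} = (m : ℝ≥0∞)⁻¹)
    (hi_unif : ∀ k c, μ {ω | i k ω = c} = (n : ℝ≥0∞)⁻¹)
    (hj_unif : ∀ k c, μ {ω | j k ω = c} = (m : ℝ≥0∞)⁻¹)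
    {T : Ω → EuclideanSpace ℝ (Fin N)} (hT : Measurable T) (hT2 : MemLp T 2 μ)
    (hindep : iIndepFun (epochIndex a i j) μ)
    (hindepT : IndepFun (fun ω p => epochIndex a i j p ω) T μ)
    {xs : EuclideanSpace ℝ (Fin N)} (hxs : gradf Gc DG gF xs = 0) {ν γ : ℝ} (hν : 0 < ν)
    (hmono : ∀ x, ν * ‖x - xs‖ ^ 2 ≤ ⟪gradf Gc DG gF x, x - xs⟫) (hνL : ν ≤ Lf)
    (hγ : γ = ν / (32 * Lf ^ 2)) (hAc : 512 * BG ^ 4 * LF ^ 2 / ν ^ 2 ≤ (A : ℝ))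
    (hKc : 512 * Lf ^ 2 / ν ^ 2 ≤ (K : ℝ))
    {x : ℕ → Ω → EuclideanSpace ℝ (Fin N)} (hx0 : x 0 = T)
    (hrec : ∀ k, ∀ hk : k < K, ∀ ω, x (k + 1) ω = x k ω - γ • svrgDirection Gc DG gF
      (fun l => a ⟨k, hk⟩ l ω) (i ⟨k, hk⟩ ω) (j ⟨k, hk⟩ ω) (T ω) (x k ω)) :
    (K : ℝ)⁻¹ * ∑ k ∈ Finset.range K, ∫ ω, ‖x k ω - xs‖ ^ 2 ∂μ
      ≤ 7 / 8 * ∫ ω, ‖T ω - xs‖ ^ 2 ∂μ := by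
  have hL := hR.pos_Lf
  let past : ℕ → Set (Fin K × Fin (A + 2)) := fun k => {p | (p.1 : ℕ) < k}
  let 𝓕 : ℕ → MeasurableSpace Ω := fun k => history (epochIndex a i j) T (past k)
  have hU := measurable_epochIndex (a := a) (i := i) (j := j) ha_meas hi_meas hj_meas
  have h𝓕 : ∀ k, 𝓕 k ≤ mΩ := fun k => history_le hU hT _
  have hmeas : ∀ k ≤ K, Measurable[𝓕 k] (x k) := by
    intro k
    induction k with
    | zero =>
      intro _
      rw [hx0]
      exact measurable_history _ _ _
    | succ k ih =>
      intro hk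
      have hkK : k < K := hk
      have hxk : Measurable[𝓕 (k + 1)] (x k) :=
        (ih hkK.le).mono (history_mono _ _ fun p (hp : (p.1 : ℕ) < k) => Nat.lt_succ_of_lt hp)
          le_rfl
      have hmem : ∀ l, ((⟨k, hkK⟩, l) : Fin K × Fin (A + 2)) ∈ past (k + 1) := fun _ =>
        Nat.lt_succ_self k
      rw [show x (k + 1) = _ from funext (hrec k hkK)]
      let _ := 𝓕 (k + 1)
      exact hxk.sub ((measurable_svrgDirection hR
        (fun l => measurable_history_index T (hmem _) (epochIndex_batch ⟨k, hkK⟩ l))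
        (measurable_history_index T (hmem _) (epochIndex_outer ⟨k, hkK⟩))
        (measurable_history_index T (hmem _) (epochIndex_jacobian ⟨k, hkK⟩))
        (measurable_history _ _ _) hxk).const_smul γ)
  have hpair : ∀ k (hk : k < K) (s t : Fin (A + 2)), s ≠ t → ∀ {c d : ℕ} {p : Ω → Fin c}
      {q : Ω → Fin d}, (∀ ω, epochIndex a i j (⟨k, hk⟩, s) ω = p ω) →
      (∀ ω, epochIndex a i j (⟨k, hk⟩, t) ω = q ω) →
      (∀ e, μ {ω | p ω = e} = (c : ℝ≥0∞)⁻¹) → (∀ e, μ {ω | q ω = e} = (d : ℝ≥0∞)⁻¹) →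
      UniformPairIndep (𝓕 k) μ p q := by
    intro k hk s t hst c d p q hp hq hpu hqu
    exact uniformPairIndep_history hU hT hindep hindepT (lt_irrefl k) (lt_irrefl k)
      (fun h => hst (congrArg Prod.snd h)) hp hq hpu hqu
  have hstep : ∀ k, ∀ hk : k < K, MemLp (x k) 2 μ → _ := fun k hk hxk =>
    svrg_one_step hR hA (h𝓕 k) (ha_meas ⟨k, hk⟩) (hi_meas ⟨k, hk⟩) (hj_meas ⟨k, hk⟩)
      (measurable_history _ _ _) (hmeas k hk.le) hT2 hxk
      (fun l l' hll => hpair k hk _ _ (fun h => hll (Fin.ext (Fin.mk.inj h)))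
        (epochIndex_batch ⟨k, hk⟩ l) (epochIndex_batch ⟨k, hk⟩ l') (ha_unif _ _) (ha_unif _ _))
      (hpair k hk _ _ (fun h => by simpa using congrArg Fin.val h)
        (epochIndex_jacobian ⟨k, hk⟩) (epochIndex_outer ⟨k, hk⟩) (hj_unif _) (hi_unif _))
      hxs hν hmono hνL hγ hAc (hrec k hk)
  have hmem : ∀ k ≤ K, MemLp (x k) 2 μ := by
    intro k
    induction k with
    | zero => exact fun _ => hx0 ▸ hT2
    | succ k ih => exact fun hk => (hstep k hk (ih (Nat.le_of_succ_le hk))).1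
  have hsum := sum_le_of_contraction_recursion (D := fun k => ∫ ω, ‖x k ω - xs‖ ^ 2 ∂μ)
    (α := 7 / 5 * (γ * ν)) (β := 13 / 20 * (γ * ν)) (K := K) fun k hk => by
      simp only [hx0]
      exact (hstep k hk (hmem k hk.le)).2
  have hD0 : 0 ≤ ∫ ω, ‖T ω - xs‖ ^ 2 ∂μ := integral_nonneg fun ω => by positivity
  have hDK : 0 ≤ ∫ ω, ‖x K ω - xs‖ ^ 2 ∂μ := integral_nonneg fun ω => by positivity
  simp only [hx0] at hsum
  have hK' : (0 : ℝ) < K := by exact_mod_cast hK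
  have hγpos : 0 < γ := by rw [hγ]; positivity
  have hKγ : 16 ≤ K * (γ * ν) := by
    rw [div_le_iff₀ (by positivity)] at hKc
    rw [hγ, div_mul_eq_mul_div, mul_div_assoc', le_div_iff₀ (by positivity)]
    linarith
  generalize ∑ k ∈ Finset.range K, ∫ ω, ‖x k ω - xs‖ ^ 2 ∂μ = S at *
  generalize ∫ ω, ‖T ω - xs‖ ^ 2 ∂μ = D0 at *
  rw [inv_mul_le_iff₀ hK']
  have h1 : 16 * D0 ≤ K * (γ * ν) * D0 := by gcongr
  have h2 : 0 ≤ K * (γ * ν) * D0 := by positivity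
  have h3 : γ * ν * S ≤ γ * ν * (K * (7 / 8 * D0)) := by linarith
  exact le_of_mul_le_mul_left h3 (by positivity)

end Epoch

/-- Corollary 1: linear per-epoch contraction of Compositional-SVRG-1. -/
theorem stmt9
    (N M m n : ℕ) (hN : 0 < N) (hM : 0 < M) (hm : 0 < m) (hn : 0 < n)
    (Gc : Fin m → EuclideanSpace ℝ (Fin N) → EuclideanSpace ℝ (Fin M))
    (DG : Fin m → EuclideanSpace ℝ (Fin N) → (EuclideanSpace ℝ (Fin N) →L[ℝ] EuclideanSpace ℝ (Fin M)))
    (hGc : ∀ j, ContDiff ℝ 1 (Gc j))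
    (hDG : ∀ (j : Fin m) (x : EuclideanSpace ℝ (Fin N)), HasFDerivAt (Gc j) (DG j x) x)
    (Fc : Fin n → EuclideanSpace ℝ (Fin M) → ℝ)
    (gF : Fin n → EuclideanSpace ℝ (Fin M) → EuclideanSpace ℝ (Fin M))
    (hFc : ∀ i, ContDiff ℝ 1 (Fc i))
    (hgF : ∀ (i : Fin n) (y : EuclideanSpace ℝ (Fin M)), HasGradientAt (Fc i) (gF i y) y)
    (BG : ℝ) (hBG : 0 < BG)
    (hBGb : ∀ (j : Fin m) (x : EuclideanSpace ℝ (Fin N)), ‖DG j x‖ ≤ BG)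
    (LF : ℝ) (hLF : 0 < LF)
    (hLFb : ∀ (i : Fin n) (u v : EuclideanSpace ℝ (Fin M)), ‖gF i u - gF i v‖ ≤ LF * ‖u - v‖)
    (Lf : ℝ) (hLf : 0 < Lf)
    (hLfb : ∀ (x y : EuclideanSpace ℝ (Fin N)) (i : Fin n) (j : Fin m),
      ‖ContinuousLinearMap.adjoint (DG j x) (gF i (Gbar Gc x))
        - ContinuousLinearMap.adjoint (DG j y) (gF i (Gbar Gc y))‖ ≤ Lf * ‖x - y‖)
    (μf : ℝ) (hμf : 0 < μf)
    (hsc : ∀ x y : EuclideanSpace ℝ (Fin N),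
      fObj Gc Fc y ≥ fObj Gc Fc x + ⟪gradf Gc DG gF x, y - x⟫ + μf / 2 * ‖y - x‖ ^ 2)
    (xstar : EuclideanSpace ℝ (Fin N)) (hxstar : ∀ x, fObj Gc Fc xstar ≤ fObj Gc Fc x)
    (Ω : Type*) [MeasurableSpace Ω] (μ : Measure Ω) [IsProbabilityMeasure μ]
    (γ : ℝ) (hγpos : 0 < γ) (K : ℕ) (hK : 1 ≤ K) (A : ℕ) (hA : 1 ≤ A)
    (xt : Ω → EuclideanSpace ℝ (Fin N)) (hxt : MemLp xt 2 μ)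
    (a : Fin K → Fin A → Ω → Fin m) (i : Fin K → Ω → Fin n) (j : Fin K → Ω → Fin m)
    (ha_meas : ∀ (k : Fin K) (l : Fin A), Measurable (a k l))
    (hi_meas : ∀ k : Fin K, Measurable (i k)) (hj_meas : ∀ k : Fin K, Measurable (j k))
    (ha_unif : ∀ (k : Fin K) (l : Fin A) (c : Fin m), μ {ω | a k l ω = c} = (m : ℝ≥0∞)⁻¹)
    (hi_unif : ∀ (k : Fin K) (c : Fin n), μ {ω | i k ω = c} = (n : ℝ≥0∞)⁻¹)
    (hj_unif : ∀ (k : Fin K) (c : Fin m), μ {ω | j k ω = c} = (m : ℝ≥0∞)⁻¹)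
    (hidx_indep : iIndepFun (m := fun _ : Fin K × Fin (A + 2) => (inferInstance : MeasurableSpace ℕ))
      (fun p : Fin K × Fin (A + 2) => fun ω =>
        if h : ((p.2 : ℕ)) < A then ((a p.1 ⟨(p.2 : ℕ), h⟩ ω : ℕ))
        else if (p.2 : ℕ) = A then ((i p.1 ω : ℕ)) else ((j p.1 ω : ℕ))) μ)
    (hindep : IndepFun
      (fun ω => fun p : Fin K × Fin (A + 2) =>
        if h : ((p.2 : ℕ)) < A then ((a p.1 ⟨(p.2 : ℕ), h⟩ ω : ℕ))
        else if (p.2 : ℕ) = A then ((i p.1 ω : ℕ)) else ((j p.1 ω : ℕ)))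
      xt μ)
    (x : ℕ → Ω → EuclideanSpace ℝ (Fin N))
    (hx0 : x 0 = xt)
    (hrec : ∀ k, ∀ hk : k < K, x (k + 1) = fun ω =>
      x k ω - γ • (ContinuousLinearMap.adjoint (DG (j ⟨k, hk⟩ ω) (x k ω)) (gF (i ⟨k, hk⟩ ω)
            (Gbar Gc (xt ω) - (A : ℝ)⁻¹ •
              ∑ l : Fin A, (Gc (a ⟨k, hk⟩ l ω) (xt ω) - Gc (a ⟨k, hk⟩ l ω) (x k ω))))
          - ContinuousLinearMap.adjoint (DG (j ⟨k, hk⟩ ω) (xt ω)) (gF (i ⟨k, hk⟩ ω) (Gbar Gc (xt ω)))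
          + gradf Gc DG gF (xt ω)))
    (hγ : γ = μf / (32 * Lf ^ 2))
    (hAc : 512 * BG ^ 4 * LF ^ 2 / μf ^ 2 ≤ (A : ℝ))
    (hKc : 512 * Lf ^ 2 / μf ^ 2 ≤ (K : ℝ)) :
    (K : ℝ)⁻¹ * ∑ k ∈ Finset.range K, ∫ ω, ‖x k ω - xstar‖ ^ 2 ∂μ
      ≤ 7 / 8 * ∫ ω, ‖xt ω - xstar‖ ^ 2 ∂μ := by
  have hR : CompositionalRegularity Gc DG gF BG LF Lf :=
    { pos_m := hm
      pos_n := hn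
      pos_BG := hBG
      pos_LF := hLF
      pos_Lf := hLf
      lipschitz_inner := fun j u v =>
        convex_univ.norm_image_sub_le_of_norm_hasFDerivWithin_le
          (fun x _ => (hDG j x).hasFDerivWithinAt) (fun x _ => hBGb j x) trivial trivial
      continuous_deriv := fun j => by
        rw [show DG j = fderiv ℝ (Gc j) from funext fun x => (hDG j x).fderiv.symm]
        exact (hGc j).continuous_fderiv one_ne_zero
      norm_deriv_le := hBGb
      lipschitz_outer := hLFb
      lipschitz_comp := hLfb }
  have hgrad : gradf Gc DG gF xstar = 0 :=
    eq_zero_of_isMin_of_minorization hLf hμf hR.lipschitz_gradf hsc hxstar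
  have hmono := le_inner_of_eq_zero_of_minorization hsc hgrad
  have hμL : μf ≤ Lf := by
    have : NeZero N := ⟨hN.ne'⟩
    obtain ⟨y, hy⟩ := exists_ne xstar
    have hpos : 0 < ‖y - xstar‖ := norm_pos_iff.2 (sub_ne_zero.2 hy)
    have h1 := hR.lipschitz_gradf y xstar
    rw [hgrad, sub_zero] at h1
    have h2 : μf * ‖y - xstar‖ ^ 2 ≤ Lf * ‖y - xstar‖ ^ 2 :=
      calc _ ≤ ‖gradf Gc DG gF y‖ * ‖y - xstar‖ := (hmono y).trans (real_inner_le_norm _ _)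
        _ ≤ Lf * ‖y - xstar‖ * ‖y - xstar‖ := by gcongr
        _ = _ := by ring
    exact le_of_mul_le_mul_right h2 (by positivity)
  obtain ⟨T, hT, hTeq⟩ := hxt.1.aemeasurable
  let iter : EuclideanSpace ℝ (Fin N) → ℕ → Ω → EuclideanSpace ℝ (Fin N) := fun t k ω =>
    svrgIterate Gc DG gF γ (fun k l => a k l ω) (fun k => i k ω) (fun k => j k ω) t k
  have hxiter : ∀ k ≤ K, ∀ ω, x k ω = iter (xt ω) k ω := by
    intro k
    induction k with
    | zero =>
      intro _ ω
      rw [hx0]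
      rfl
    | succ k ih =>
      intro hk ω
      have hkK : k < K := hk
      rw [hrec k hkK]
      simp only [iter, svrgIterate, hkK, dif_pos]
      rw [ih hkK.le ω]
      rfl
  have hmain := svrg_epoch_contraction hR hA hK ha_meas hi_meas hj_meas ha_unif hi_unif hj_unif hT
    (hxt.ae_eq hTeq) hidx_indep (hindep.congr (Filter.EventuallyEq.refl _ _) hTeq) hgrad hμf hmono
    hμL hγ hAc hKc (x := fun k ω => iter (T ω) k ω) rfl
    (fun k hk ω => by simp only [iter, svrgIterate, hk, dif_pos])
  have hint : ∀ k ≤ K, ∫ ω, ‖x k ω - xstar‖ ^ 2 ∂μ = ∫ ω, ‖iter (T ω) k ω - xstar‖ ^ 2 ∂μ := by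
    intro k hk
    refine integral_congr_ae ?_
    filter_upwards [hTeq] with ω hω
    rw [hxiter k hk ω, hω]
  rw [Finset.sum_congr rfl fun k hk => hint k (Finset.mem_range.1 hk).le]
  have hint0 : ∫ ω, ‖xt ω - xstar‖ ^ 2 ∂μ = ∫ ω, ‖T ω - xstar‖ ^ 2 ∂μ := by
    refine integral_congr_ae ?_
    filter_upwards [hTeq] with ω hω
    rw [hω]
  rw [hint0]
  exact hmain
end
end
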